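/- Let k be a field of characteristic 2 and let G = Alt(7) be the alternating group on 7 letters. Then every simple kG-module is algebraic. -/

import Mathlib

open CategoryTheory CategoryTheory.MonoidalCategory

namespace AlgebraicModule

variable {k G : Type} [Field k] [Monoid G]

/-- `N` is a direct summand of `M`, i.e. a retract of `M`. -/
def IsSummand (N M : FDRep k G) : Prop :=
  ∃ (i : N ⟶ M) (r : M ⟶ N), i ≫ r = 𝟙 N

/-- `M` is an indecomposable module: it is nonzero and is not the direct sum of two
nonzero submodules (equivalently, its only idempotent endomorphisms are `0` and `1`). -/
def Indecomposable (M : FDRep k G) : Prop :=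
  ¬ Limits.IsZero M ∧ ∀ e : M ⟶ M, e ≫ e = e → e = 0 ∨ e = 𝟙 M

/-- `tensorPow M n` is the tensor power `M^{⊗ (n + 1)}`, with diagonal `G`-action. -/
noncomputable def tensorPow (M : FDRep k G) : ℕ → FDRep k G
  | 0 => M
  | n + 1 => tensorPow M n ⊗ M

/-- `M` is algebraic: only finitely many isomorphism classes of indecomposable modules
occur as direct summands of the tensor powers `M^{⊗ n}` for `n ≥ 1`. -/
noncomputable def IsAlgebraic (M : FDRep k G) : Prop :=
  ∃ L : List (FDRep k G), ∀ N : FDRep k G, Indecomposable N →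
    (∃ n : ℕ, IsSummand N (tensorPow M n)) → ∃ N' ∈ L, Nonempty (N ≅ N')

end AlgebraicModule

open AlgebraicModule


open CategoryTheory CategoryTheory.MonoidalCategory
open AlgebraicModule

namespace A7



lemma unit_or_nilp (k : Type*) {A : Type*} [Field k] [Ring A] [Algebra k A] [FiniteDimensional k A] (h : ∀ e : A, e * e = e → e = 0 ∨ e = 1) (a : A) :
    IsUnit a ∨ IsNilpotent a := by
  classical
  obtain ⟨p, hp, hpa⟩ := Algebra.IsIntegral.isIntegral (R := k) a
  have hp0 : p ≠ 0 := hp.ne_zero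
  obtain ⟨q, hq, hq0⟩ := Polynomial.exists_eq_pow_rootMultiplicity_mul_and_not_dvd p hp0 0
  set m := p.rootMultiplicity 0
  simp only [map_zero, sub_zero] at hq hq0
  have hcop : IsCoprime (Polynomial.X ^ m : Polynomial k) q := by
    apply IsCoprime.pow_left
    rw [Polynomial.irreducible_X.coprime_iff_not_dvd]
    exact hq0
  obtain ⟨u, v, huv⟩ := hcop
  have h0 : Polynomial.aeval a (Polynomial.X ^ m * q) = 0 := by
    rw [← hq]; exact hpa
  set x := Polynomial.aeval a (u * Polynomial.X ^ m) with hx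
  set y := Polynomial.aeval a (v * q) with hy
  have hxy : x + y = 1 := by rw [hx, hy, ← map_add, huv, map_one]
  have hxy0 : x * y = 0 := by
    rw [hx, hy, ← map_mul]
    have : (u * Polynomial.X ^ m) * (v * q) = (u * v) * (Polynomial.X ^ m * q) := by ring
    rw [this, map_mul, h0, mul_zero]
  have hid : x * x = x := by
    have : x * (x + y) = x := by rw [hxy, mul_one]
    rwa [mul_add, hxy0, add_zero] at this
  rcases h x hid with h1 | h1
  · right
    refine ⟨m, ?_⟩
    have h2 : y = 1 := by simpa [h1] using hxy
    have h3 : Polynomial.aeval a (Polynomial.X ^ m : Polynomial k) * y = 0 := by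
      rw [hy, ← map_mul]
      have : Polynomial.X ^ m * (v * q) = v * (Polynomial.X ^ m * q) := by ring
      rw [this, map_mul, h0, mul_zero]
    simpa [h2] using h3
  · left
    rcases Nat.eq_zero_or_pos m with hm | hm
    · -- q(a) = 0, q(0) ≠ 0
      have hqa : Polynomial.aeval a q = 0 := by simpa [hm] using h0
      have hc : q.coeff 0 ≠ 0 := by
        intro hc; exact hq0 (Polynomial.X_dvd_iff.2 hc)
      have e1 : Polynomial.X * q.divX + Polynomial.C (q.coeff 0) = q :=
        Polynomial.X_mul_divX_add q
      have e2 : a * Polynomial.aeval a q.divX = - algebraMap k A (q.coeff 0) := by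
        have := congrArg (Polynomial.aeval a) e1
        simp only [map_add, map_mul, Polynomial.aeval_X, Polynomial.aeval_C, hqa] at this
        exact eq_neg_of_add_eq_zero_left this
      have e3 : Polynomial.aeval a q.divX * a = - algebraMap k A (q.coeff 0) := by
        rw [← e2]
        have := congrArg (Polynomial.aeval a) (mul_comm q.divX Polynomial.X)
        simpa using this
      have e4 : IsUnit (- algebraMap k A (q.coeff 0)) :=
        ((IsUnit.mk0 _ hc).map (algebraMap k A)).neg
      have hcom : Commute a (Polynomial.aeval a q.divX) := by
        unfold Commute SemiconjBy; rw [e2, e3]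
      exact (hcom.isUnit_mul_iff.1 (e2 ▸ e4)).1
    · obtain ⟨n, hn⟩ : ∃ n, m = n + 1 := ⟨m - 1, by omega⟩
      have e2 : a * Polynomial.aeval a (u * Polynomial.X ^ n) = 1 := by
        rw [← h1, hx, hn]
        have : (u * Polynomial.X ^ (n+1)) = Polynomial.X * (u * Polynomial.X ^ n) := by ring
        rw [this]; simp
      have e3 : Polynomial.aeval a (u * Polynomial.X ^ n) * a = 1 := by
        rw [← h1, hx, hn]
        have : (u * Polynomial.X ^ (n+1)) = (u * Polynomial.X ^ n) * Polynomial.X := by ring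
        rw [this]; simp
      exact ⟨⟨a, _, e2, e3⟩, rfl⟩

lemma nonunit_add (k : Type*) {A : Type*} [Field k] [Ring A] [Algebra k A] [FiniteDimensional k A] (h : ∀ e : A, e * e = e → e = 0 ∨ e = 1) (a b : A)
    (ha : ¬ IsUnit a) (hb : ¬ IsUnit b) : ¬ IsUnit (a + b) := by
  rintro ⟨u, hu⟩
  have h1 : (↑u⁻¹ : A) * a + ↑u⁻¹ * b = 1 := by rw [← mul_add, ← hu]; simp
  rcases unit_or_nilp k h (↑u⁻¹ * a) with h2 | h2
  · apply ha
    have := u.isUnit.mul h2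
    simpa using this
  · apply hb
    have h3 : IsUnit (1 - ↑u⁻¹ * a) := h2.isUnit_one_sub
    rw [← h1] at h3
    have := u.isUnit.mul h3
    simpa using this


variable {k G : Type} [Field k] [Group G]

/-- maps that are sums of maps factoring through objects in `P` -/
def FacSet (P : FDRep k G → Prop) (A B : FDRep k G) : AddSubgroup (A ⟶ B) :=
  AddSubgroup.closure {f | ∃ X, P X ∧ ∃ (i : A ⟶ X) (r : X ⟶ B), f = i ≫ r}

/-- the identity is a sum of maps factoring through objects in `P` -/
def Fac (P : FDRep k G → Prop) (A : FDRep k G) : Prop := 𝟙 A ∈ FacSet P A A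

variable {P P' : FDRep k G → Prop}

lemma facSet_map {A B A' B' : FDRep k G} (F : (A ⟶ B) →+ (A' ⟶ B'))
    (hF : ∀ X, P X → ∀ (i : A ⟶ X) (r : X ⟶ B), F (i ≫ r) ∈ FacSet P' A' B')
    {f : A ⟶ B} (hf : f ∈ FacSet P A B) : F f ∈ FacSet P' A' B' := by
  have : FacSet P A B ≤ (FacSet P' A' B').comap F := by
    unfold FacSet
    rw [AddSubgroup.closure_le]
    rintro f ⟨X, hX, i, r, rfl⟩
    exact hF X hX i r
  exact this hf

lemma mem_facSet {A B X : FDRep k G} (hX : P X) (i : A ⟶ X) (r : X ⟶ B) :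
    i ≫ r ∈ FacSet P A B :=
  AddSubgroup.subset_closure ⟨X, hX, i, r, rfl⟩

lemma facSet_comp {A B A' B' : FDRep k G} (g : A' ⟶ A) (h : B ⟶ B')
    {f : A ⟶ B} (hf : f ∈ FacSet P A B) : g ≫ f ≫ h ∈ FacSet P A' B' := by
  let F : (A ⟶ B) →+ (A' ⟶ B') :=
    { toFun := fun f => g ≫ f ≫ h, map_zero' := by simp, map_add' := by intros; simp }
  refine facSet_map F ?_ hf
  intro X hX i r
  have : F (i ≫ r) = (g ≫ i) ≫ (r ≫ h) := by simp [F]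
  rw [this]; exact mem_facSet hX _ _

lemma facSet_through {A B X : FDRep k G} (hX : Fac P X) (i : A ⟶ X) (r : X ⟶ B) :
    i ≫ r ∈ FacSet P A B := by
  have := facSet_comp i r hX
  simpa using this

lemma Fac.of {A : FDRep k G} (h : P A) : Fac P A := by
  have := mem_facSet h (𝟙 A) (𝟙 A); simpa [Fac] using this

lemma Fac.trans {A : FDRep k G} (h : Fac P A) (hP : ∀ X, P X → Fac P' X) : Fac P' A := by
  have := facSet_map (P' := P') (AddMonoidHom.id (A ⟶ A))
    (fun X hX i r => facSet_through (hP X hX) i r) h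
  simpa [Fac] using this

lemma Fac.retract {A N : FDRep k G} (h : Fac P A) (hN : IsSummand N A) : Fac P N := by
  obtain ⟨i, r, hir⟩ := hN
  have := facSet_through h i r
  rwa [hir] at this

lemma Fac.iso {A N : FDRep k G} (h : Fac P A) (hN : N ≅ A) : Fac P N :=
  h.retract ⟨hN.hom, hN.inv, by simp⟩

lemma Fac.tensorRight {A Q : FDRep k G} (h : Fac P A) (hP : ∀ X, P X → Fac P' (X ⊗ Q)) :
    Fac P' (A ⊗ Q) := by
  let F : (A ⟶ A) →+ (A ⊗ Q ⟶ A ⊗ Q) :=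
    { toFun := fun f => f ▷ Q, map_zero' := by simp, map_add' := by intros; simp }
  have := facSet_map (P' := P') F
    (fun X hX i r => by
      have : F (i ≫ r) = i ▷ Q ≫ r ▷ Q := by simp [F]
      rw [this]; exact facSet_through (hP X hX) _ _) h
  simpa [Fac, F] using this

lemma Fac.tensorLeft {A Q : FDRep k G} (h : Fac P A) (hP : ∀ X, P X → Fac P' (Q ⊗ X)) :
    Fac P' (Q ⊗ A) := by
  let F : (A ⟶ A) →+ (Q ⊗ A ⟶ Q ⊗ A) :=
    { toFun := fun f => Q ◁ f, map_zero' := by simp, map_add' := by intros; simp }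
  have := facSet_map (P' := P') F
    (fun X hX i r => by
      have : F (i ≫ r) = Q ◁ i ≫ Q ◁ r := by simp [F]
      rw [this]; exact facSet_through (hP X hX) _ _) h
  simpa [Fac, F] using this

lemma end_unit_iff {N : FDRep k G} (f : N ⟶ N) : IsUnit (show End N from f) ↔ IsIso f :=
  isUnit_iff_isIso f

lemma indec_of_fac {N : FDRep k G} (hN : AlgebraicModule.Indecomposable N) (h : Fac P N) :
    ∃ X, P X ∧ IsSummand N X := by
  by_contra hcon
  have hidem : ∀ e : End N, e * e = e → e = 0 ∨ e = 1 := fun e he => hN.2 e he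
  have h01 : (0 : N ⟶ N) ≠ 𝟙 N := fun h0 => hN.1 ((Limits.IsZero.iff_id_eq_zero N).2 h0.symm)
  have hfd : FiniteDimensional k (End N) := inferInstanceAs (FiniteDimensional k (N ⟶ N))
  have key : ∀ f ∈ FacSet P N N, ¬ IsIso f := by
    intro f hf
    refine AddSubgroup.closure_induction (p := fun f _ => ¬ IsIso f) ?_ ?_ ?_ ?_ hf
    · rintro f ⟨X, hX, i, r, rfl⟩ hiso
      exact hcon ⟨X, hX, i, r ≫ inv (i ≫ r), by rw [← Category.assoc]; simp⟩
    · intro hiso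
      apply h01
      have h5 := IsIso.hom_inv_id (0 : N ⟶ N)
      rwa [Limits.zero_comp] at h5
    · intro x y _ _ hx hy
      have := nonunit_add k hidem x y
        (fun h => hx ((end_unit_iff x).1 h)) (fun h => hy ((end_unit_iff y).1 h))
      exact fun h => this ((end_unit_iff (x + y)).2 h)
    · intro x _ hx hiso
      apply hx
      have := (end_unit_iff (-x)).2 hiso
      have h2 : IsUnit (-(show End N from x)) := this
      rw [IsUnit.neg_iff] at h2
      exact (end_unit_iff x).1 h2
  exact key _ h inferInstance

lemma indec_iso {N X : FDRep k G} (hN : AlgebraicModule.Indecomposable N) (hX : AlgebraicModule.Indecomposable X)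
    (h : IsSummand N X) : Nonempty (N ≅ X) := by
  obtain ⟨i, r, hir⟩ := h
  have he : (r ≫ i) ≫ (r ≫ i) = r ≫ i := by
    rw [Category.assoc, ← Category.assoc i, hir, Category.id_comp]
  rcases hX.2 _ he with h0 | h1
  · exfalso
    apply hN.1
    rw [Limits.IsZero.iff_id_eq_zero]
    calc 𝟙 N = i ≫ (r ≫ i) ≫ r := by simp [hir]
      _ = 0 := by rw [h0]; simp
  · exact ⟨⟨i, r, hir, h1⟩⟩

lemma exists_split {X : FDRep k G} (e : X ⟶ X) (he : e ≫ e = e) :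
    ∃ (Y : FDRep k G) (i : Y ⟶ X) (r : X ⟶ Y), i ≫ r = 𝟙 Y ∧ r ≫ i = e := by
  have : IsIdempotentComplete (FDRep k G) := inferInstance
  exact this.idempotents_split X e he

lemma finrank_lt {X Y : FDRep k G} (i : Y ⟶ X) (r : X ⟶ Y) (hir : i ≫ r = 𝟙 Y)
    (hne : r ≫ i ≠ 𝟙 X) : Module.finrank k (Y ⟶ Y) < Module.finrank k (X ⟶ X) := by
  let F : (Y ⟶ Y) →ₗ[k] (X ⟶ X) :=
    { toFun := fun f => r ≫ f ≫ i
      map_add' := by intros; simp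
      map_smul' := by intros; simp }
  have hinj : Function.Injective F := by
    intro f g hfg
    have h : r ≫ f ≫ i = r ≫ g ≫ i := hfg
    have h2 : i ≫ (r ≫ f ≫ i) ≫ r = i ≫ (r ≫ g ≫ i) ≫ r := by rw [h]
    simp only [Category.assoc, hir, Category.comp_id] at h2
    rw [← Category.assoc, hir, ← Category.assoc, hir] at h2
    simpa using h2
  rw [← LinearMap.finrank_range_of_inj hinj]
  apply Submodule.finrank_lt
  intro htop
  have : 𝟙 X ∈ LinearMap.range F := htop ▸ Submodule.mem_top
  obtain ⟨f, hf⟩ := this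
  apply hne
  have hf' : r ≫ f ≫ i = 𝟙 X := hf
  calc r ≫ i = (r ≫ i) ≫ (r ≫ f ≫ i) := by rw [hf']; simp
    _ = r ≫ (i ≫ r) ≫ f ≫ i := by simp
    _ = r ≫ f ≫ i := by rw [hir]; simp
    _ = _ := hf'

lemma exists_indec_list (n : ℕ) : ∀ X : FDRep k G, Module.finrank k (X ⟶ X) ≤ n →
    ∃ L : List (FDRep k G), (∀ Y ∈ L, AlgebraicModule.Indecomposable Y) ∧ Fac (· ∈ L) X := by
  induction n with
  | zero =>
    intro X hX
    refine ⟨[], by simp, ?_⟩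
    have : Subsingleton (X ⟶ X) := Module.finrank_zero_iff.1 (Nat.le_zero.1 hX)
    unfold Fac
    rw [Subsingleton.elim (𝟙 X) 0]
    exact zero_mem _
  | succ n ih =>
    intro X hX
    by_cases hi : AlgebraicModule.Indecomposable X
    · exact ⟨[X], by simpa using hi, Fac.of (by simp)⟩
    by_cases hz : Limits.IsZero X
    · refine ⟨[], by simp, ?_⟩
      unfold Fac
      rw [(Limits.IsZero.iff_id_eq_zero X).1 hz]
      exact zero_mem _
    have : ∃ e : X ⟶ X, e ≫ e = e ∧ e ≠ 0 ∧ e ≠ 𝟙 X := by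
      by_contra hcon
      push Not at hcon
      exact hi ⟨hz, fun e he => or_iff_not_imp_left.2 (hcon e he)⟩
    obtain ⟨e, he, he0, he1⟩ := this
    obtain ⟨Y, i, r, hir, hri⟩ := exists_split e he
    obtain ⟨Y', i', r', hir', hri'⟩ := exists_split (𝟙 X - e) (by simp [he])
    have h1 := finrank_lt i r hir (hri ▸ he1)
    have h2 := finrank_lt i' r' hir' (by
      rw [hri']; intro h; exact he0 (by simpa using h))
    obtain ⟨L, hL, hF⟩ := ih Y (by omega)
    obtain ⟨L', hL', hF'⟩ := ih Y' (by omega)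
    refine ⟨L ++ L', ?_, ?_⟩
    · intro Z hZ
      rcases List.mem_append.1 hZ with h | h
      · exact hL _ h
      · exact hL' _ h
    · have e1 : 𝟙 X = r ≫ i + r' ≫ i' := by rw [hri, hri']; simp
      unfold Fac
      rw [e1]
      exact add_mem
        (facSet_through (hF.trans fun Z hZ => Fac.of (List.mem_append_left _ hZ)) r i)
        (facSet_through (hF'.trans fun Z hZ => Fac.of (List.mem_append_right _ hZ)) r' i')

/-- The main finiteness criterion. -/
lemma isAlgebraic_of_fac (M : FDRep k G) (L : List (FDRep k G))
    (h : ∀ n, Fac (· ∈ L) (tensorPow M n)) : IsAlgebraic M := by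
  choose F hF hF' using fun X : FDRep k G => exists_indec_list _ X le_rfl
  refine ⟨L.flatMap F, ?_⟩
  rintro N hN ⟨n, hn⟩
  have h1 : Fac (· ∈ L) N := (h n).retract hn
  obtain ⟨X, hX, hNX⟩ := indec_of_fac hN h1
  obtain ⟨Y, hY, hNY⟩ := indec_of_fac hN ((hF' X).retract hNX)
  exact ⟨Y, List.mem_flatMap.2 ⟨X, hX, hY⟩, indec_iso hN (hF X Y hY) hNY⟩

end A7

open CategoryTheory CategoryTheory.MonoidalCategory
open AlgebraicModule

namespace A7
open scoped Kronecker
variable {k G : Type} [Field k] [Group G]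

/-- a morphism of `FDRep` from an equivariant linear map -/
noncomputable def mkHom (A B : FDRep k G) (f : A →ₗ[k] B)
    (h : ∀ g, f ∘ₗ A.ρ g = B.ρ g ∘ₗ f) : A ⟶ B where
  hom := InducedCategory.homMk (ModuleCat.ofHom f)
  comm g := by
    ext x
    exact LinearMap.congr_fun (h g) x

/-- the linear map of a morphism -/
noncomputable def lin {A B : FDRep k G} (f : A ⟶ B) : A →ₗ[k] B := f.hom.hom.hom

lemma lin_mkHom (A B : FDRep k G) (f : A →ₗ[k] B) (h) : lin (mkHom A B f h) = f := rfl

lemma lin_comp {A B C : FDRep k G} (f : A ⟶ B) (g : B ⟶ C) : lin (f ≫ g) = lin g ∘ₗ lin f := rfl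
lemma lin_id (A : FDRep k G) : lin (𝟙 A) = LinearMap.id := rfl
lemma lin_add {A B : FDRep k G} (f g : A ⟶ B) : lin (f + g) = lin f + lin g := rfl
lemma lin_zero {A B : FDRep k G} : lin (0 : A ⟶ B) = 0 := rfl
lemma lin_ext {A B : FDRep k G} {f g : A ⟶ B} (h : lin f = lin g) : f = g := by
  ext x
  exact LinearMap.congr_fun h x
lemma lin_comm {A B : FDRep k G} (f : A ⟶ B) (g : G) : lin f ∘ₗ A.ρ g = B.ρ g ∘ₗ lin f := by
  ext x
  exact ConcreteCategory.congr_hom ((forget (FGModuleCat k)).congr_map (f.comm g)) x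

/-- isomorphism from an equivariant linear equivalence -/
noncomputable def mkIso' (A B : FDRep k G) (f : A ≃ₗ[k] B)
    (h : ∀ g, f.toLinearMap ∘ₗ A.ρ g = B.ρ g ∘ₗ f.toLinearMap) : A ≅ B where
  hom := mkHom A B f h
  inv := mkHom B A f.symm (fun g => by
    ext x
    apply f.injective
    have := LinearMap.congr_fun (h g) (f.symm x)
    simp at this
    simp [this])
  hom_inv_id := by
    apply lin_ext; rw [lin_comp, lin_mkHom, lin_mkHom, lin_id]; ext; simp
  inv_hom_id := by
    apply lin_ext; rw [lin_comp, lin_mkHom, lin_mkHom, lin_id]; ext; simp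

section mat
variable {ι κ μ : Type} [Fintype ι] [DecidableEq ι] [Fintype κ] [DecidableEq κ]
  [Fintype μ] [DecidableEq μ]

/-- the representation given by a matrix representation -/
noncomputable def FM (ρ : G →* Matrix ι ι k) : FDRep k G :=
  FDRep.of (V := ι → k) ((Matrix.toLinAlgEquiv' (R := k) (n := ι)).toRingEquiv.toMonoidHom.comp ρ)

lemma FM_ρ (ρ : G →* Matrix ι ι k) (g : G) : (FM ρ).ρ g = Matrix.toLin' (ρ g) := rfl

/-- hom from an intertwining matrix -/
noncomputable def homOf {ρ : G →* Matrix ι ι k} {σ : G →* Matrix κ κ k} (X : Matrix κ ι k)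
    (h : ∀ g, X * ρ g = σ g * X) : FM ρ ⟶ FM σ :=
  mkHom (FM ρ) (FM σ) (Matrix.toLin' X) (fun g => by
    rw [FM_ρ, FM_ρ]
    exact (Matrix.toLin'_mul X (ρ g)).symm.trans ((congrArg _ (h g)).trans (Matrix.toLin'_mul _ _)))

lemma lin_homOf {ρ : G →* Matrix ι ι k} {σ : G →* Matrix κ κ k} (X : Matrix κ ι k)
    (h : ∀ g, X * ρ g = σ g * X) : lin (homOf X h) = Matrix.toLin' X := rfl

/-- The Kronecker product of matrix reps -/
noncomputable def kr (ρ : G →* Matrix ι ι k) (σ : G →* Matrix κ κ k) :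
    G →* Matrix (ι × κ) (ι × κ) k where
  toFun g := ρ g ⊗ₖ σ g
  map_one' := by simp
  map_mul' g h := by simp [Matrix.mul_kronecker_mul]

lemma kr_apply (ρ : G →* Matrix ι ι k) (σ : G →* Matrix κ κ k) (g : G) :
  kr ρ σ g = ρ g ⊗ₖ σ g := rfl

lemma tensor_aux (A : Matrix ι ι k) (B : Matrix κ κ k) :
    (((Pi.basisFun k ι).tensorProduct (Pi.basisFun k κ)).equivFun).toLinearMap ∘ₗ
      TensorProduct.map (Matrix.toLin' A) (Matrix.toLin' B) =
    Matrix.toLin' (A ⊗ₖ B) ∘ₗ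
      (((Pi.basisFun k ι).tensorProduct (Pi.basisFun k κ)).equivFun).toLinearMap := by
  apply ((Pi.basisFun k ι).tensorProduct (Pi.basisFun k κ)).ext
  rintro ⟨i, j⟩
  have e : ((Pi.basisFun k ι).tensorProduct (Pi.basisFun k κ)).equivFun
      (((Pi.basisFun k ι).tensorProduct (Pi.basisFun k κ)) (i, j)) = Pi.single (i, j) 1 := by
    rw [Module.Basis.equivFun_apply, Module.Basis.repr_self, Finsupp.single_eq_pi_single]
  rw [LinearMap.comp_apply, LinearMap.comp_apply, LinearEquiv.coe_coe, e,
    Module.Basis.tensorProduct_apply, TensorProduct.map_tmul, Module.Basis.equivFun_apply]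
  funext ⟨a, b⟩
  rw [Module.Basis.tensorProduct_repr_tmul_apply]
  simp [mul_comm]

/-- tensor iso -/
noncomputable def tensorFM (ρ : G →* Matrix ι ι k) (σ : G →* Matrix κ κ k) :
    FM ρ ⊗ FM σ ≅ FM (kr ρ σ) :=
  mkIso' _ _ (((Pi.basisFun k ι).tensorProduct (Pi.basisFun k κ)).equivFun) (fun g => by
    have h1 : (FM ρ ⊗ FM σ).ρ g = TensorProduct.map (Matrix.toLin' (ρ g)) (Matrix.toLin' (σ g)) := rfl
    rw [h1, FM_ρ]
    exact tensor_aux (ρ g) (σ g))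

end mat
end A7

open CategoryTheory CategoryTheory.MonoidalCategory
open AlgebraicModule

namespace A7
open scoped Kronecker
variable {k G : Type} [Field k] [Group G]

/-- permutation matrices -/
def permM (k G Z : Type) [Field k] [Group G] [Fintype Z] [DecidableEq Z] [MulAction G Z] :
    G →* Matrix Z Z k where
  toFun g := Matrix.of fun z w => if z = g • w then 1 else 0
  map_one' := by ext z w; simp [Matrix.one_apply]
  map_mul' g h := by
    ext z w
    simp [Matrix.mul_apply, mul_smul]

lemma permM_apply (Z : Type) [Fintype Z] [DecidableEq Z] [MulAction G Z] (g : G) (z w : Z) :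
    permM k G Z g z w = if z = g • w then 1 else 0 := rfl

/-- powers of `U` -/
noncomputable def Epow (U : FDRep k G) : ℕ → FDRep k G
  | 0 => 𝟙_ _
  | n + 1 => Epow U n ⊗ U

/-- the class of objects `k^Z ⊗ U^n`, `n < 3`. -/
def PC (U : FDRep k G) (X : FDRep k G) : Prop :=
  ∃ (Z : Type) (_ : Fintype Z) (_ : DecidableEq Z) (_ : MulAction G Z) (n : ℕ), n < 3 ∧
    X = FM (permM k G Z) ⊗ Epow U n

section
variable (Z Y : Type) [Fintype Z] [DecidableEq Z] [MulAction G Z]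
  [Fintype Y] [DecidableEq Y] [MulAction G Y]

lemma kr_perm : kr (permM k G Z) (permM k G Y) = permM k G (Z × Y) := by
  ext g ⟨a, b⟩ ⟨c, d⟩
  simp only [kr_apply, permM_apply, Matrix.kroneckerMap_apply, Prod.ext_iff, Prod.smul_mk]
  by_cases h1 : a = g • c <;> by_cases h2 : b = g • d <;> simp [h1, h2]

noncomputable def permProd : FM (permM k G Z) ⊗ FM (permM k G Y) ≅ FM (permM k G (Z × Y)) :=
  (tensorFM _ _) ≪≫ eqToIso (by rw [kr_perm])

end

variable {U : FDRep k G}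

lemma PC_perm_left (Y : Type) [Fintype Y] [DecidableEq Y] [MulAction G Y] (X : FDRep k G)
    (hX : PC U X) : Fac (PC U) (FM (permM k G Y) ⊗ X) := by
  obtain ⟨Z, _, _, _, n, hn, rfl⟩ := hX
  refine Fac.iso (Fac.of ⟨Y × Z, inferInstance, inferInstance, inferInstance, n, hn, rfl⟩) ?_
  exact (α_ _ _ _).symm ≪≫ whiskerRightIso (permProd Y Z) _

lemma PC_perm_right (Y : Type) [Fintype Y] [DecidableEq Y] [MulAction G Y] (X : FDRep k G)
    (hX : PC U X) : Fac (PC U) (X ⊗ FM (permM k G Y)) :=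
  (PC_perm_left Y X hX).iso (β_ _ _)

lemma PC_U (h3 : Fac (PC U) (Epow U 3)) (X : FDRep k G)
    (hX : PC U X) : Fac (PC U) (X ⊗ U) := by
  obtain ⟨Z, _, _, _, n, hn, rfl⟩ := hX
  have e : (FM (permM k G Z) ⊗ Epow U n) ⊗ U ≅ FM (permM k G Z) ⊗ Epow U (n + 1) := α_ _ _ _
  refine Fac.iso ?_ e
  by_cases h : n + 1 < 3
  · exact Fac.of ⟨Z, _, _, _, n+1, h, rfl⟩
  · obtain rfl : n = 2 := by omega
    exact h3.tensorLeft (fun X hX => PC_perm_left Z X hX)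

lemma PC_Uperm (h3 : Fac (PC U) (Epow U 3)) (Y : Type) [Fintype Y] [DecidableEq Y] [MulAction G Y]
    (X : FDRep k G) (hX : PC U X) : Fac (PC U) (X ⊗ (U ⊗ FM (permM k G Y))) :=
  ((PC_U h3 X hX).tensorRight (fun X hX => PC_perm_right Y X hX)).iso (α_ _ _ _).symm

/-- the trivial action on a point -/
@[reducible] def unitAct (G : Type) [Group G] : MulAction G Unit :=
  { smul := fun _ x => x, one_smul := fun _ => rfl, mul_smul := fun _ _ _ => rfl }

lemma one_aux (g : G) (x : k) : letI := unitAct G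
    Matrix.toLin' (permM k G Unit g) ((LinearEquiv.funUnique Unit k k).symm x) =
      (LinearEquiv.funUnique Unit k k).symm x := by
  funext i
  simp [Matrix.mulVec, dotProduct, permM_apply]

lemma PC_one : Fac (PC U) (𝟙_ (FDRep k G)) := by
  refine Fac.iso (Fac.of ⟨Unit, inferInstance, inferInstance,
    unitAct G, 0, by omega, rfl⟩) ?_
  refine ?_ ≪≫ (ρ_ _).symm
  refine mkIso' _ _ (LinearEquiv.funUnique Unit k k).symm ?_
  intro g
  refine LinearMap.ext fun x => ?_
  refine Eq.trans ?_ (one_aux g x).symm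
  rfl

lemma tensorPow_fac {M Q : FDRep k G} (hM : IsSummand M Q)
    (hQ : ∀ X, PC U X → Fac (PC U) (X ⊗ Q)) (n : ℕ) : Fac (PC U) (tensorPow M n) := by
  obtain ⟨i, r, hir⟩ := hM
  induction n with
  | zero =>
    have h1 : Fac (PC U) (𝟙_ _ ⊗ Q) := PC_one.tensorRight hQ
    exact (h1.iso (λ_ Q).symm).retract ⟨i, r, hir⟩
  | succ n ih =>
    have h1 : Fac (PC U) (tensorPow M n ⊗ Q) := ih.tensorRight hQ
    have h2 : IsSummand (tensorPow M n ⊗ M) (tensorPow M n ⊗ Q) :=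
      ⟨tensorPow M n ◁ i, tensorPow M n ◁ r, by
        rw [← MonoidalCategory.whiskerLeft_comp, hir, MonoidalCategory.whiskerLeft_id]⟩
    exact h1.retract h2

/-- the transitive permutation modules -/
noncomputable def transFM [Finite G] (H : Subgroup G) : FDRep k G :=
  @FM k G _ _ (G ⧸ H) (Fintype.ofFinite _) (Classical.decEq _)
    (@permM k G (G ⧸ H) _ _ (Fintype.ofFinite _) (Classical.decEq _) _)

/-- matrices of maps between matrix representations factoring through `P`. -/
def MFac (P : FDRep k G → Prop) {ι : Type} [Fintype ι] [DecidableEq ι]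
    (ρ : G →* Matrix ι ι k) (m : Matrix ι ι k) : Prop :=
  ∃ (κ : Type) (_ : Fintype κ) (_ : DecidableEq κ) (σ : G →* Matrix κ κ k)
    (A : Matrix ι κ k) (B : Matrix κ ι k), Fac P (FM σ) ∧
    (∀ g, A * σ g = ρ g * A) ∧ (∀ g, B * ρ g = σ g * B) ∧ m = A * B

lemma fac_of_MFac {P : FDRep k G → Prop} {ι : Type} [Fintype ι] [DecidableEq ι]
    {ρ : G →* Matrix ι ι k} (Ω : Type) [Fintype Ω] (m : Ω → Matrix ι ι k)
    (hm : ∀ w, MFac P ρ (m w)) (h1 : ∑ w, m w = 1) : Fac P (FM ρ) := by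
  have h2 : ∀ w, ∃ f : FM ρ ⟶ FM ρ, f ∈ FacSet P (FM ρ) (FM ρ) ∧ lin f = Matrix.toLin' (m w) := by
    intro w
    obtain ⟨κ, _, _, σ, A, B, hP, hA, hB, hAB⟩ := hm w
    refine ⟨homOf B hB ≫ homOf A hA, facSet_through hP _ _, ?_⟩
    rw [lin_comp, lin_homOf, lin_homOf, hAB]
    exact (Matrix.toLin'_mul A B).symm
  choose f hf hf' using h2
  have : 𝟙 (FM ρ) = ∑ w, f w := by
    apply lin_ext
    let F : (FM ρ ⟶ FM ρ) →+ (FM ρ →ₗ[k] FM ρ) :=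
      { toFun := lin, map_zero' := lin_zero, map_add' := lin_add }
    refine Eq.trans ?_ (map_sum F f Finset.univ).symm
    have h3 : ∀ w, F (f w) = Matrix.toLin' (m w) := hf'
    simp only [h3]
    rw [lin_id]
    refine Eq.trans ?_ (map_sum (Matrix.toLin' (R := k)) m Finset.univ)
    rw [h1, Matrix.toLin'_one]
    rfl
  unfold Fac
  rw [this]
  exact sum_mem fun w _ => hf w

section gmap
variable {Z Y : Type} [Fintype Z] [DecidableEq Z] [MulAction G Z]
  [Fintype Y] [DecidableEq Y] [MulAction G Y]

/-- matrix of a map of sets -/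
def fmat (k : Type) [Field k] (f : Y → Z) : Matrix Z Y k := Matrix.of fun z y => if z = f y then 1 else 0

lemma fmat_perm (f : Y → Z) (hf : ∀ (g : G) y, f (g • y) = g • f y) (g : G) :
    fmat k f * permM k G Y g = permM k G Z g * fmat k f := by
  ext z y
  simp [Matrix.mul_apply, fmat, permM_apply, hf]

lemma permM_transpose (g : G) : (permM k G Z g).transpose = permM k G Z g⁻¹ := by
  ext z w
  simp [permM_apply, eq_inv_smul_iff, eq_comm]

lemma fmat_perm' (f : Y → Z) (hf : ∀ (g : G) y, f (g • y) = g • f y) (g : G) :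
    (fmat k f).transpose * permM k G Z g = permM k G Y g * (fmat k f).transpose := by
  have := congrArg Matrix.transpose (fmat_perm (k := k) f hf g⁻¹)
  rw [Matrix.transpose_mul, Matrix.transpose_mul, permM_transpose, permM_transpose, inv_inv] at this
  exact this.symm

end gmap

lemma perm_fac [Finite G] (Z : Type) [Fintype Z] [DecidableEq Z] [MulAction G Z] :
    Fac (fun X => ∃ H : Subgroup G, X = transFM H) (FM (permM k G Z)) := by
  let Ω := Quotient (MulAction.orbitRel G Z)
  let _ : DecidableEq Ω := Classical.decEq _
  let _ : Fintype Ω := Fintype.ofFinite _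
  let sec : Ω → Z := Quotient.out
  let _ : ∀ H : Subgroup G, Fintype (G ⧸ H) := fun H => Fintype.ofFinite _
  let _ : ∀ H : Subgroup G, DecidableEq (G ⧸ H) := fun H => Classical.decEq _
  have hs : ∀ w (g : G) y, MulAction.ofQuotientStabilizer G (sec w) (g • y) =
      g • MulAction.ofQuotientStabilizer G (sec w) y := fun w g y =>
    MulAction.ofQuotientStabilizer_smul _ _ _ _
  refine fac_of_MFac Ω (fun w => fmat k (MulAction.ofQuotientStabilizer G (sec w)) *
    (fmat k (MulAction.ofQuotientStabilizer G (sec w))).transpose) ?_ ?_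
  · intro w
    exact ⟨G ⧸ MulAction.stabilizer G (sec w), Fintype.ofFinite _, Classical.decEq _,
      permM k G (G ⧸ MulAction.stabilizer G (sec w)), _, _,
      Fac.of ⟨MulAction.stabilizer G (sec w), rfl⟩, fmat_perm _ (hs w), fmat_perm' _ (hs w), rfl⟩
  · ext z z'
    rw [Matrix.sum_apply]
    simp only [Matrix.mul_apply, fmat, Matrix.of_apply, Matrix.transpose_apply]
    have key : ∀ w : Ω, (∑ q, (if z = MulAction.ofQuotientStabilizer G (sec w) q then (1:k) else 0) *
        (if z' = MulAction.ofQuotientStabilizer G (sec w) q then (1:k) else 0)) =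
        if w = Quotient.mk _ z then (if z = z' then 1 else 0) else 0 := by
      intro w
      split_ifs with h1 h2
      · subst h2
        have hz : z ∈ MulAction.orbit G (sec w) := by
          rw [← MulAction.orbitRel_apply]
          have : (Quotient.mk (MulAction.orbitRel G Z) z) = Quotient.mk _ (sec w) := by
            rw [← h1]; exact (Quotient.out_eq w).symm
          exact Quotient.exact this
        obtain ⟨g, hg⟩ := hz
        rw [Finset.sum_eq_single (QuotientGroup.mk g)]
        · have : z = MulAction.ofQuotientStabilizer G (sec w) (QuotientGroup.mk g) := hg.symm
          simp [← this]
        · intro q _ hq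
          rw [if_neg, zero_mul]
          intro h
          apply hq
          apply MulAction.injective_ofQuotientStabilizer G (sec w)
          rw [← h]; exact hg.symm
        · simp
      · apply Finset.sum_eq_zero
        intro q _
        by_cases h3 : z = MulAction.ofQuotientStabilizer G (sec w) q
        · rw [if_neg (c := z' = _), mul_zero]
          intro h; exact h2 (h3.trans h.symm)
        · rw [if_neg h3, zero_mul]
      · apply Finset.sum_eq_zero
        intro q _
        rw [if_neg, zero_mul]
        intro h
        apply h1
        have : Quotient.mk (MulAction.orbitRel G Z) (sec w) = Quotient.mk _ z := by
          apply Quotient.sound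
          refine (MulAction.orbitRel G Z).symm ?_
          obtain ⟨g, rfl⟩ := QuotientGroup.mk_surjective q
          exact ⟨g, h.symm⟩
        rw [← this]; exact (Quotient.out_eq w).symm
    simp only [key]
    simp [Matrix.one_apply]

lemma list_fac [Finite G] : ∃ L : List (FDRep k G), ∀ A, Fac (PC U) A → Fac (· ∈ L) A := by
  classical
  have : Fintype (Subgroup G) := Fintype.ofFinite _
  refine ⟨(Finset.univ : Finset (Subgroup G)).toList.flatMap
    (fun H => (List.range 3).map (fun n => transFM H ⊗ Epow U n)), fun A hA => hA.trans ?_⟩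
  rintro X ⟨Z, _, _, _, n, hn, rfl⟩
  refine (perm_fac Z).tensorRight ?_
  rintro X ⟨H, rfl⟩
  refine Fac.of ?_
  simp only [List.mem_flatMap, Finset.mem_toList, Finset.mem_univ, true_and, List.mem_map, List.mem_range]
  exact ⟨H, n, hn, rfl⟩

theorem algebraic_of [Finite G] (h3 : Fac (PC U) (Epow U 3)) (M : FDRep k G)
    (h : (∃ (Y : Type) (_ : Fintype Y) (_ : DecidableEq Y) (_ : MulAction G Y),
      IsSummand M (FM (permM k G Y)) ∨ IsSummand M (U ⊗ FM (permM k G Y)))) : IsAlgebraic M := by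
  obtain ⟨L, hL⟩ := list_fac (U := U)
  apply isAlgebraic_of_fac M L
  intro n
  apply hL
  obtain ⟨Y, _, _, _, h | h⟩ := h
  · exact tensorPow_fac h (fun X hX => PC_perm_right Y X hX) n
  · exact tensorPow_fac h (fun X hX => PC_Uperm h3 Y X hX) n

end A7

open CategoryTheory CategoryTheory.MonoidalCategory
open AlgebraicModule

namespace A7

/-- xor-sum -/
def xsum (n : ℕ) (f : ℕ → ℕ) : ℕ := Nat.rec 0 (fun i acc => Nat.xor acc (f i)) n

/-- the bit `s` of `M`, as a number -/
def bn (M s : ℕ) : ℕ := Nat.mod (Nat.shiftRight M s) 2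

/-- product of bit-coded matrices -/
def mulN (n m p A B : ℕ) : ℕ :=
  xsum n fun i => Nat.shiftLeft (xsum m fun j => Nat.mul (bn A (Nat.add (Nat.mul i m) j))
    (Nat.mod (Nat.shiftRight B (Nat.mul j p)) (Nat.pow 2 p))) (Nat.mul i p)

/-- bit-coded matrix from a function with values in 0,1 -/
def ofFnN (n m : ℕ) (f : ℕ → ℕ → ℕ) : ℕ :=
  xsum n fun i => Nat.shiftLeft (xsum m fun j => Nat.shiftLeft (Nat.mod (f i j) 2) j) (Nat.mul i m)

section
variable (k : Type*) [CommRing k]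

/-- bit as an element of the ring -/
def bk (M s : ℕ) : k := if M.testBit s then 1 else 0

/-- matrix of a code -/
def mat (n m : ℕ) (M : ℕ) : Matrix (Fin n) (Fin m) k := Matrix.of fun i j => bk k M (i * m + j)

lemma mat_apply (n m M : ℕ) (i : Fin n) (j : Fin m) : mat k n m M i j = bk k M (i * m + j) := rfl

variable [CharP k 2]

lemma bk_xor (x y s : ℕ) : bk k (x ^^^ y) s = bk k x s + bk k y s := by
  have : (1 + 1 : k) = 0 := by
    have := CharP.cast_eq_zero k 2
    norm_num at this ⊢
    exact this
  unfold bk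
  rw [Nat.testBit_xor]
  cases x.testBit s <;> cases y.testBit s <;> simp [this]

@[simp] lemma bk_zero (s : ℕ) : bk k 0 s = 0 := by simp [bk]

lemma bk_xsum (n : ℕ) (f : ℕ → ℕ) (s : ℕ) : bk k (xsum n f) s = ∑ i ∈ Finset.range n, bk k (f i) s := by
  induction n with
  | zero => simp [xsum]
  | succ n ih =>
    rw [Finset.sum_range_succ, ← ih]
    exact bk_xor k _ _ _

lemma bn_eq (M s : ℕ) : bn M s = if M.testBit s then 1 else 0 := by
  unfold bn
  change (M >>> s) % 2 = _
  rw [Nat.testBit, Nat.one_and_eq_mod_two]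
  rcases Nat.mod_two_eq_zero_or_one (M >>> s) with h | h <;> simp [h]

lemma xsum_lt (n p : ℕ) (f : ℕ → ℕ) (h : ∀ i < n, f i < 2 ^ p) : xsum n f < 2 ^ p := by
  induction n with
  | zero => exact Nat.two_pow_pos p
  | succ n ih =>
    exact Nat.xor_lt_two_pow (ih fun i hi => h i (by omega)) (h n (by omega))

lemma bk_of_lt {M p s : ℕ} (h : M < 2 ^ p) (hs : p ≤ s) : bk k M s = 0 := by
  unfold bk
  rw [Nat.testBit_lt_two_pow (lt_of_lt_of_le h (Nat.pow_le_pow_right (by norm_num) hs))]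
  simp

lemma bk_shift (M p i j l : ℕ) (h : M < 2 ^ p) (hl : l < p) :
    bk k (M <<< (j * p)) (i * p + l) = if j = i then bk k M l else 0 := by
  unfold bk
  rw [Nat.testBit_shiftLeft]
  split_ifs with h1 h2 h3 h4 h5 h6
  all_goals first | rfl | exfalso
  · subst h2
    simp at h1; exact h3 h1
  · simp at h1
    obtain ⟨h1, h6⟩ := h1
    rcases lt_or_gt_of_ne h2 with h7 | h7
    · have : (j + 1) * p ≤ i * p := Nat.mul_le_mul_right p h7
      have h8 : p ≤ i * p + l - j * p := by rw [add_mul] at this; omega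
      rw [Nat.testBit_lt_two_pow (lt_of_lt_of_le h (Nat.pow_le_pow_right (by norm_num) h8))] at h6
      simp at h6
    · have : (i + 1) * p ≤ j * p := Nat.mul_le_mul_right p h7
      rw [add_mul] at this; omega
  · subst h4
    simp at h1
    rw [h1] at h5; simp at h5

lemma mulN_mat (n m p A B : ℕ) : mat k n m A * mat k m p B = mat k n p (mulN n m p A B) := by
  ext i l
  rw [Matrix.mul_apply, mat_apply]
  unfold mulN
  rw [bk_xsum]
  have hlt : ∀ i' : ℕ, (xsum m fun j => Nat.mul (bn A (Nat.add (Nat.mul i' m) j))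
    (Nat.mod (Nat.shiftRight B (Nat.mul j p)) (Nat.pow 2 p))) < 2 ^ p := by
    intro i'
    apply xsum_lt
    intro j _
    rw [bn_eq]
    have := Nat.mod_lt (B >>> (j * p)) (Nat.two_pow_pos p)
    split_ifs
    · change 1 * ((B >>> (j * p)) % 2 ^ p) < _
      omega
    · change 0 * ((B >>> (j * p)) % 2 ^ p) < _
      omega
  have : ∀ i' ∈ Finset.range n, bk k (Nat.shiftLeft (xsum m fun j => Nat.mul (bn A (Nat.add (Nat.mul i' m) j))
    (Nat.mod (Nat.shiftRight B (Nat.mul j p)) (Nat.pow 2 p))) (Nat.mul i' p)) (i * p + l) =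
      if i' = (i : ℕ) then bk k (xsum m fun j => Nat.mul (bn A (Nat.add (Nat.mul i' m) j))
    (Nat.mod (Nat.shiftRight B (Nat.mul j p)) (Nat.pow 2 p))) l else 0 := by
    intro i' _
    exact bk_shift k _ p i i' l (hlt i') l.2
  rw [Finset.sum_congr rfl this, Finset.sum_ite_eq', if_pos (by simp), bk_xsum, ← Fin.sum_univ_eq_sum_range
    (fun j => bk k (Nat.mul (bn A (Nat.add (Nat.mul i m) j)) (Nat.mod (Nat.shiftRight B (Nat.mul j p)) (Nat.pow 2 p))) l)]
  refine Finset.sum_congr rfl fun j _ => ?_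
  rw [bn_eq, mat_apply, mat_apply]
  change _ = bk k (_ * ((B >>> (j * p)) % 2 ^ p)) l
  have e : bk k ((B >>> ((j:ℕ) * p)) % 2 ^ p) l = bk k B (j * p + l) := by
    unfold bk
    rw [Nat.testBit_mod_two_pow, Nat.testBit_shiftRight]
    simp
  rw [← e]
  change (if A.testBit (i * m + j) then (1:k) else 0) * _ = bk k ((if A.testBit (i * m + j) then 1 else 0) * _) _
  split_ifs <;> simp

lemma ofFnN_mat (n m : ℕ) (f : ℕ → ℕ → ℕ) (i : Fin n) (j : Fin m) :
    mat k n m (ofFnN n m f) i j = (f i j : k) := by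
  rw [mat_apply]
  unfold ofFnN
  rw [bk_xsum]
  have hlt : ∀ i' : ℕ, (xsum m fun j => Nat.shiftLeft (Nat.mod (f i' j) 2) j) < 2 ^ m := by
    intro i'
    apply xsum_lt
    intro j hj
    change (f i' j % 2) <<< j < _
    have h1 : f i' j % 2 < 2 := Nat.mod_lt _ (by norm_num)
    rw [Nat.shiftLeft_eq]
    calc (f i' j % 2) * 2 ^ j < 2 * 2 ^ j := Nat.mul_lt_mul_of_pos_right h1 (Nat.two_pow_pos j)
      _ = 2 ^ (j + 1) := by ring
      _ ≤ 2 ^ m := Nat.pow_le_pow_right (by norm_num) hj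
  have : ∀ i' ∈ Finset.range n, bk k (Nat.shiftLeft (xsum m fun j => Nat.shiftLeft (Nat.mod (f i' j) 2) j) (Nat.mul i' m)) (i * m + j) =
      if i' = (i : ℕ) then bk k (xsum m fun j => Nat.shiftLeft (Nat.mod (f i' j) 2) j) j else 0 := by
    intro i' _
    exact bk_shift k _ m i i' j (hlt i') j.2
  rw [Finset.sum_congr rfl this, Finset.sum_ite_eq', if_pos (by simp), bk_xsum]
  have h2 : ∀ j' ∈ Finset.range m, bk k (Nat.shiftLeft (Nat.mod (f i j') 2) j') j =
      if j' = (j : ℕ) then (f i j' : k) else 0 := by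
    intro j' _
    have h3 := bk_shift k (f i j' % 2) 1 j j' 0 (by have := Nat.mod_lt (f i j') (y := 2) (by norm_num); omega) (by norm_num)
    rw [mul_one, mul_one, add_zero] at h3
    refine h3.trans ?_
    split_ifs with h4
    · unfold bk
      have h5 : ((f i j' : ℕ) : k) = ((f i j' % 2 : ℕ) : k) := by
        rw [CharP.natCast_eq_natCast k 2]; exact (Nat.mod_modEq _ _).symm
      rw [h5]
      rcases Nat.mod_two_eq_zero_or_one (f i j') with h | h <;> simp [h]
    · rfl
  rw [Finset.sum_congr rfl h2, Finset.sum_ite_eq', if_pos (by simp)]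

lemma mat_xor (n m A B : ℕ) : mat k n m (Nat.xor A B) = mat k n m A + mat k n m B := by
  ext i j
  exact bk_xor k _ _ _

lemma mat_zero (n m : ℕ) : mat k n m 0 = 0 := by
  ext i j
  simp [mat_apply]

lemma mat_xsum (n m t : ℕ) (f : ℕ → ℕ) :
    mat k n m (xsum t f) = ∑ i ∈ Finset.range t, mat k n m (f i) := by
  ext i j
  rw [Matrix.sum_apply]
  exact bk_xsum k _ _ _

/-- identity code -/
def oneN (n : ℕ) : ℕ := ofFnN n n fun i j => if i = j then 1 else 0

lemma mat_oneN (n : ℕ) : mat k n n (oneN n) = 1 := by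
  ext i j
  rw [oneN, ofFnN_mat]
  simp [Matrix.one_apply, Fin.ext_iff]

/-- transpose code -/
def trN (n m A : ℕ) : ℕ := ofFnN m n fun i j => bn A (j * m + i)

lemma bn_cast (M s : ℕ) : ((bn M s : ℕ) : k) = bk k M s := by
  rw [bn_eq, bk]; split_ifs <;> simp

lemma mat_trN (n m A : ℕ) : mat k m n (trN n m A) = (mat k n m A).transpose := by
  ext i j
  rw [trN, ofFnN_mat, bn_cast]; rfl

omit [CharP k 2] in
lemma mat_map {R S : Type*} [CommRing R] [CommRing S] (f : R →+* S) (n m A : ℕ) :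
    (mat R n m A).map f = mat S n m A := by
  ext i j
  simp only [Matrix.map_apply, mat_apply, bk]
  split_ifs <;> simp

end

example : mulN 64 64 64 (oneN 64) (oneN 64) = oneN 64 := by decide +kernel

end A7

open CategoryTheory CategoryTheory.MonoidalCategory
open AlgebraicModule

namespace A7

/-- the group -/
abbrev G7 : Type := alternatingGroup (Fin 7)

/-- triples -/
abbrev Tr : Type := Fin 7 × Fin 7 × Fin 7

/-- distinctness -/
def dist3 (t : Tr) : Prop := t.1 ≠ t.2.1 ∧ t.2.1 ≠ t.2.2 ∧ t.1 ≠ t.2.2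

instance : DecidablePred dist3 := fun t => by unfold dist3; infer_instance

/-- the three-cycle of a triple -/
def c3 (t : Tr) : G7 := if h : dist3 t then
  ⟨Equiv.swap t.1 t.2.1 * Equiv.swap t.2.1 t.2.2, by
    rw [Equiv.Perm.mem_alternatingGroup, map_mul, Equiv.Perm.sign_swap h.1, Equiv.Perm.sign_swap h.2.1]
    rfl⟩ else 1

/-- evaluation of words -/
def wd (w : List Tr) : G7 := (w.map c3).prod

lemma wd_cons (t : Tr) (w : List Tr) : wd (t :: w) = c3 t * wd w := by simp [wd]
lemma wd_nil : wd [] = 1 := rfl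
lemma wd_append (w w' : List Tr) : wd (w ++ w') = wd w * wd w' := by simp [wd]

lemma c3_inv (t : Tr) : (c3 t)⁻¹ = c3 (t.2.2, t.2.1, t.1) := by
  unfold c3
  have : dist3 (t.2.2, t.2.1, t.1) ↔ dist3 t := by
    unfold dist3; constructor <;> rintro ⟨h1, h2, h3⟩ <;> exact ⟨h2.symm, h1.symm, h3.symm⟩
  by_cases h : dist3 t
  · rw [dif_pos h, dif_pos (this.2 h)]
    apply Subtype.ext
    simp [Equiv.swap_comm]
  · rw [dif_neg h, dif_neg (fun h' => h (this.1 h'))]; simp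

lemma wd_surj (g : G7) : ∃ w, wd w = g := by
  have hg : g ∈ Subgroup.closure {g : G7 | Equiv.Perm.IsThreeCycle (g : Equiv.Perm (Fin 7))} := by
    rw [alternatingGroup.closure_isThreeCycles_eq_top]; trivial
  induction hg using Subgroup.closure_induction with
  | mem x hx =>
    obtain ⟨a, ha⟩ := hx.isCycle.nonempty_support
    have h1 := hx.eq_swap_mul_swap_iff_mem_support.2 ha
    have h2 := hx.nodup_iff_mem_support.2 ha
    refine ⟨[(a, x.1 a, x.1 (x.1 a))], ?_⟩
    rw [wd_cons, wd_nil, mul_one]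
    have : dist3 (a, x.1 a, x.1 (x.1 a)) := by
      simp at h2
      have h3 : ¬ x.1 a = x.1 (x.1 a) := fun h => h2.1.1 (x.1.injective h)
      exact ⟨h2.1.1, h3, h2.1.2⟩
    rw [c3, dif_pos this]
    exact Subtype.ext h1.symm
  | one => exact ⟨[], rfl⟩
  | mul x y _ _ hx hy =>
    obtain ⟨w, rfl⟩ := hx
    obtain ⟨w', rfl⟩ := hy
    exact ⟨w ++ w', wd_append _ _⟩
  | inv x h0 hx =>
    clear h0
    obtain ⟨w, rfl⟩ := hx
    induction w with
    | nil => exact ⟨[], by simp [wd_nil]⟩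
    | cons t w ih =>
      obtain ⟨w', hw'⟩ := ih
      exact ⟨w' ++ [(t.2.2, t.2.1, t.1)], by rw [wd_append, wd_cons, wd_nil, mul_one, hw', wd_cons, mul_inv_rev, c3_inv]⟩

/-- codes of the forms -/
def TN (i : ℕ) : ℕ := [4680, 9156, 31116, 27346, 22554, 19286, 12702].getD i 0
/-- codes of the inverse forms -/
def TiN (i : ℕ) : ℕ := [4680, 12684, 9174, 22814, 19026, 30874, 27588].getD i 0

/-- code of the matrix of a generator -/
def m3N (t : Tr) : ℕ := if dist3 t then
  mulN 4 4 4 (Nat.xor (TiN t.1) (TiN t.2.1)) (Nat.xor (TN t.2.1) (TN t.2.2)) else oneN 4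

lemma rel_check : ∀ t : Tr, ∀ i : Fin 7, mulN 4 4 4 (trN 4 4 (m3N t)) (mulN 4 4 4 (TN ((c3 t).1 i)) (m3N t)) = TN i := by
  decide +kernel

lemma T_inv : ∀ i : Fin 7, mulN 4 4 4 (TiN i) (TN i) = oneN 4 ∧ mulN 4 4 4 (TN i) (TiN i) = oneN 4 := by
  decide +kernel

/-- certificate that the algebra is everything -/
def cenC (i j : ℕ) : ℕ := [0, 922121, 661038, 396319, 919057, 0, 792631, 661033, 67371059, 34086414, 0, 922128, 101449789, 67371023, 919072, 0].getD (i * 4 + j) 0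

/-- generators of the algebra -/
def XN (j : ℕ) : ℕ := mulN 4 4 4 (TiN 0) (TN j)

lemma cen_check : ∀ i j : Fin 4, i ≠ j → xsum 28 (fun s => Nat.mul (bn (cenC i j) s) (mulN 4 4 4 (XN (s / 7)) (XN (s % 7)))) =
    2 ^ ((i : ℕ) * 4 + j) := by decide +kernel

section
variable (k : Type) [Field k] [CharP k 2]

/-- the seven forms -/
def TT (i : Fin 7) : Matrix (Fin 4) (Fin 4) k := mat k 4 4 (TN i)
/-- the seven inverse forms -/
def TTi (i : Fin 7) : Matrix (Fin 4) (Fin 4) k := mat k 4 4 (TiN i)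

lemma TTi_TT (i : Fin 7) : TTi k i * TT k i = 1 := by
  rw [TTi, TT, mulN_mat, (T_inv i).1, mat_oneN]
lemma TT_TTi (i : Fin 7) : TT k i * TTi k i = 1 := by
  rw [TTi, TT, mulN_mat, (T_inv i).2, mat_oneN]

variable {k}
/-- the defining relation -/
def Rel (g : G7) (m : Matrix (Fin 4) (Fin 4) k) : Prop := ∀ i, m.transpose * (TT k (g.1 i) * m) = TT k i

lemma Rel.mul {g h : G7} {m n : Matrix (Fin 4) (Fin 4) k} (h1 : Rel g m) (h2 : Rel h n) : Rel (g * h) (m * n) := by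
  intro i
  have h3 := h1 (h.1 i)
  rw [Matrix.transpose_mul]
  calc n.transpose * m.transpose * (TT k (g.1 (h.1 i)) * (m * n))
      = n.transpose * ((m.transpose * (TT k (g.1 (h.1 i)) * m)) * n) := by noncomm_ring
    _ = _ := by rw [h3, h2]

lemma Rel.one : Rel (1 : G7) (1 : Matrix (Fin 4) (Fin 4) k) := by
  intro i; simp

lemma rel_c3 (t : Tr) : Rel (c3 t) (mat k 4 4 (m3N t)) := by
  intro i
  rw [TT, TT, ← mat_trN, mulN_mat, mulN_mat, rel_check]

/-- code of the matrix of a word -/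
def um (w : List Tr) : ℕ := w.foldr (fun t x => mulN 4 4 4 (m3N t) x) (oneN 4)

lemma rel_wd (w : List Tr) : Rel (wd w) (mat k 4 4 (um w)) := by
  induction w with
  | nil => rw [wd_nil]; simp only [um, List.foldr_nil, mat_oneN]; exact Rel.one
  | cons t w ih =>
    rw [wd_cons]; simp only [um, List.foldr_cons]
    rw [← mulN_mat]
    exact (rel_c3 t).mul ih

lemma Rel.inv_left {g : G7} {m : Matrix (Fin 4) (Fin 4) k} (h : Rel g m) :
    (TTi k 0 * m.transpose * TT k (g.1 0)) * m = 1 := by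
  have := h 0
  calc _ = TTi k 0 * (m.transpose * (TT k (g.1 0) * m)) := by noncomm_ring
    _ = 1 := by rw [this, TTi_TT]

lemma rel_one_eq {n : Matrix (Fin 4) (Fin 4) k} (h : Rel (1 : G7) n) : n = 1 := by
  have h' : ∀ i, n.transpose * (TT k i * n) = TT k i := h
  obtain ⟨m, hm⟩ : ∃ m, m = TTi k 0 * n.transpose * TT k 0 := ⟨_, rfl⟩
  have hmn : m * n = 1 := by rw [hm]; exact h.inv_left
  have hnm : n * m = 1 := mul_eq_one_comm.1 hmn
  have hc0 : ∀ j, Commute n (TTi k 0 * TT k j) := by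
    intro j
    have h1 : n.transpose * TT k j = TT k j * m := by
      rw [← h' j]; rw [show n.transpose * (TT k j * n) * m = n.transpose * TT k j * (n * m) by noncomm_ring, hnm, mul_one, h']
    have h2 : TTi k 0 * n.transpose = m * TTi k 0 := by
      rw [hm, mul_assoc _ (TT k 0), TT_TTi, mul_one]
    have h3 : m * (TTi k 0 * TT k j) = TTi k 0 * TT k j * m := by
      rw [← mul_assoc, ← h2, mul_assoc, h1, mul_assoc]
    have h4 : Commute m (TTi k 0 * TT k j) := h3
    change n * (TTi k 0 * TT k j) = TTi k 0 * TT k j * n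
    calc n * (TTi k 0 * TT k j) = n * ((TTi k 0 * TT k j) * m) * n := by
          rw [mul_assoc n, mul_assoc _ m, hmn, mul_one]
      _ = _ := by rw [← h3, ← mul_assoc, hnm, one_mul]
  have hc : ∀ j : ℕ, j < 7 → Commute n (mat k 4 4 (XN j)) := by
    intro j hj
    rw [XN, ← mulN_mat]
    exact hc0 ⟨j, hj⟩
  have hE : Pairwise fun i j => Commute (Matrix.single i j (1:k)) n := by
    intro i j hij
    have h1 := cen_check i j hij
    have h2 : Matrix.single i j (1:k) = mat k 4 4 (2 ^ ((i : ℕ) * 4 + j)) := by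
      ext a b
      rw [mat_apply, bk, Nat.testBit_two_pow, Matrix.single_apply]
      have : (i = a ∧ j = b) ↔ ((i : ℕ) * 4 + j = (a : ℕ) * 4 + b) := by omega
      simp only [this, decide_eq_true_eq]
    rw [h2, ← h1, mat_xsum]
    refine Commute.symm (Commute.sum_right _ _ _ fun s hs => ?_)
    have hs' := Finset.mem_range.1 hs
    rw [bn_eq]
    split_ifs
    · rw [show Nat.mul 1 (mulN 4 4 4 (XN (s / 7)) (XN (s % 7))) = mulN 4 4 4 (XN (s / 7)) (XN (s % 7)) from one_mul _, ← mulN_mat]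
      exact (hc _ (by omega)).mul_right (hc _ (by omega))
    · rw [show Nat.mul 0 (mulN 4 4 4 (XN (s / 7)) (XN (s % 7))) = 0 from zero_mul _, mat_zero]
      exact Commute.zero_right _
  obtain ⟨c, rfl⟩ := Matrix.mem_range_scalar_of_commute_single hE
  have h5 := congrFun (congrFun (h' 0) 0) 3
  have h6 : TT k 0 0 3 = 1 := by simp [TT, mat, bk, TN, Nat.testBit]
  rw [Matrix.scalar_apply, Matrix.diagonal_transpose, Matrix.diagonal_mul, Matrix.mul_diagonal, h6] at h5
  have h7 : (c - 1) * (c - 1) = 0 := by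
    have h2 : (2 : k) = 0 := by exact_mod_cast CharP.cast_eq_zero k 2
    linear_combination h5 + (1 - c) * h2
  have h8 : c = 1 := by
    rcases mul_eq_zero.1 h7 with h | h <;> exact sub_eq_zero.1 h
  rw [h8]; simp

lemma Rel.unique {g : G7} {m n : Matrix (Fin 4) (Fin 4) k} (h1 : Rel g m) (h2 : Rel g n) : m = n := by
  obtain ⟨w, hw⟩ := wd_surj g⁻¹
  have h3 := rel_wd (k := k) w
  rw [hw] at h3
  have h4 := rel_one_eq (by simpa using h3.mul h1)
  have h5 := rel_one_eq (by simpa using h3.mul h2)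
  have h6 := mul_eq_one_comm.1 h4
  calc m = m * (mat k 4 4 (um w) * n) := by rw [h5, mul_one]
    _ = n := by rw [← mul_assoc, h6, one_mul]

variable (k) in
/-- the four-dimensional representation -/
noncomputable def phi : G7 →* Matrix (Fin 4) (Fin 4) k where
  toFun g := mat k 4 4 (um (wd_surj g).choose)
  map_one' := by
    have := rel_wd (k := k) (wd_surj 1).choose
    rw [(wd_surj 1).choose_spec] at this
    exact rel_one_eq this
  map_mul' g h := by
    have h1 := rel_wd (k := k) (wd_surj g).choose
    have h2 := rel_wd (k := k) (wd_surj h).choose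
    have h3 := rel_wd (k := k) (wd_surj (g * h)).choose
    rw [(wd_surj _).choose_spec] at h1 h2 h3
    exact h3.unique (h1.mul h2)

lemma rel_phi (g : G7) : Rel g (phi k g) := by
  have h1 := rel_wd (k := k) (wd_surj g).choose
  rw [(wd_surj _).choose_spec] at h1
  exact h1

lemma phi_wd (w : List Tr) : phi k (wd w) = mat k 4 4 (um w) := (rel_phi _).unique (rel_wd w)
lemma phi_c3 (t : Tr) : phi k (c3 t) = mat k 4 4 (m3N t) := (rel_phi _).unique (rel_c3 t)

end
end A7

open CategoryTheory CategoryTheory.MonoidalCategory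
open AlgebraicModule

namespace A7
set_option linter.unusedSimpArgs false
set_option linter.unusedSectionVars false
open scoped Kronecker

/-- code of a triple Kronecker product -/
def k3N (m p q : ℕ) : ℕ := ofFnN 64 64 fun i j =>
  Nat.mul (bn m (Nat.add (Nat.mul (Nat.div i 16) 4) (Nat.div j 16)))
   (Nat.mul (bn p (Nat.add (Nat.mul (Nat.mod (Nat.div i 4) 4) 4) (Nat.mod (Nat.div j 4) 4)))
    (bn q (Nat.add (Nat.mul (Nat.mod i 4) 4) (Nat.mod j 4))))

/-- the certificate -/
def thN : ℕ := 0x400cc0000000000000000000000000002000000000000002501db00000000003602e100000000001200a400000000001200da000000000000000000000000000000a500000000000000000000000000020301000000000010000100000000000000c800000000002303120000000000110233000000000000000000000000000000000000000000000000000000000000000000000000000000000000000000000000000000000000000000000000000000000000000000000000000000000000000000000000000000000000000000000000000000000000000000000000000000000000000000000000000000000000000000000000000000000000000000030016000000000000000000000000000101d6000000000010036000000000002201fb00000000001201900000000000390079000000000000000000000000000500340000000000000000000000000002036f000000000012003600000000000701b000000000002001550000000000020287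

/-- the words of the stabilizer -/
def hW : List (List Tr) := [[], [(3, 4, 5)], [(3, 4, 6)], [(3, 5, 4)], [(3, 5, 6)], [(3, 6, 4)], [(3, 6, 5)], [(4, 5, 6)], [(4, 6, 5)], [(3, 4, 6), (3, 4, 5)], [(3, 6, 5), (3, 4, 5)], [(4, 5, 6), (3, 4, 5)]]

/-- inverse word -/
def iw (w : List Tr) : List Tr := (w.map fun t => (t.2.2, t.2.1, t.1)).reverse

/-- code of the projection -/
def e0N : ℕ := ofFnN 64 64 fun i j =>
  (Nat.add (Nat.mul (if Nat.beq (Nat.div i 16) (Nat.mod j 4) then 1 else 0) (Nat.mul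
   (bn (TiN 0) (Nat.add (Nat.mul (Nat.mod (Nat.div i 4) 4) 4) (Nat.mod i 4)))
   (bn (TN 0) (Nat.add (Nat.mul (Nat.div j 16) 4) (Nat.mod (Nat.div j 4) 4)))))
   (Nat.mul (if Nat.beq (Nat.mod i 4) (Nat.div j 16) then 1 else 0) (Nat.mul
   (bn (TiN 0) (Nat.add (Nat.mul (Nat.div i 16) 4) (Nat.mod (Nat.div i 4) 4)))
   (bn (TN 0) (Nat.add (Nat.mul (Nat.mod (Nat.div j 4) 4) 4) (Nat.mod j 4))))))

set_option maxRecDepth 100000 in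
lemma th_check : (hW.map fun w => mulN 64 64 64 (k3N (um w) (um w) (um w))
   (mulN 64 64 64 thN (k3N (um (iw w)) (um (iw w)) (um (iw w))))).foldr Nat.xor 0 =
   mulN 64 64 64 (k3N (m3N (0,1,2)) (oneN 4) (oneN 4)) (Nat.xor (oneN 64) e0N) := by decide +kernel

/-- triple index set -/
abbrev V3 : Type := (Fin 4 × Fin 4) × Fin 4

/-- numbering -/
def e3 : V3 ≃ Fin 64 := (Equiv.prodCongr finProdFinEquiv (Equiv.refl _)).trans finProdFinEquiv

lemma e3_val (x : V3) : ((e3 x : Fin 64) : ℕ) = x.2 + 4 * (x.1.2 + 4 * x.1.1) := by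
  simp [e3, finProdFinEquiv]

section
variable {k : Type} [Field k] [CharP k 2]

lemma k3N_mat (m p q : ℕ) : (mat k 64 64 (k3N m p q)).submatrix e3 e3 =
    (mat k 4 4 m ⊗ₖ mat k 4 4 p) ⊗ₖ mat k 4 4 q := by
  ext ⟨⟨a, b⟩, c⟩ ⟨⟨a', b'⟩, c'⟩
  rw [Matrix.submatrix_apply, k3N, ofFnN_mat]
  simp only [Matrix.kroneckerMap_apply, mat_apply]
  have h1 : Nat.div (e3 ((a, b), c) : Fin 64) 16 = a := by
    rw [e3_val]; change _ / 16 = _; simp only; omega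
  have h2 : Nat.mod (Nat.div (e3 ((a, b), c) : Fin 64) 4) 4 = b := by
    rw [e3_val]; change (_ / 4) % 4 = _; simp only; omega
  have h3 : Nat.mod (e3 ((a, b), c) : Fin 64) 4 = c := by
    rw [e3_val]; change _ % 4 = _; simp only; omega
  have h1' : Nat.div (e3 ((a', b'), c') : Fin 64) 16 = a' := by
    rw [e3_val]; change _ / 16 = _; simp only; omega
  have h2' : Nat.mod (Nat.div (e3 ((a', b'), c') : Fin 64) 4) 4 = b' := by
    rw [e3_val]; change (_ / 4) % 4 = _; simp only; omega
  have h3' : Nat.mod (e3 ((a', b'), c') : Fin 64) 4 = c' := by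
    rw [e3_val]; change _ % 4 = _; simp only; omega
  rw [h1, h2, h3, h1', h2', h3']
  simp only [Nat.mul_eq, Nat.add_eq]
  push_cast
  rw [bn_cast, bn_cast, bn_cast, mul_assoc]

/-- contraction 1 -/
def al1 (T : Matrix (Fin 4) (Fin 4) k) : Matrix (Fin 4) V3 k := Matrix.of fun l x =>
  T x.1.1 x.1.2 * (1 : Matrix (Fin 4) (Fin 4) k) l x.2
/-- contraction 2 -/
def al2 (T : Matrix (Fin 4) (Fin 4) k) : Matrix (Fin 4) V3 k := Matrix.of fun l x =>
  T x.1.2 x.2 * (1 : Matrix (Fin 4) (Fin 4) k) l x.1.1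
/-- insertion 1 -/
def be1 (T : Matrix (Fin 4) (Fin 4) k) : Matrix V3 (Fin 4) k := Matrix.of fun x l =>
  T x.1.2 x.2 * (1 : Matrix (Fin 4) (Fin 4) k) x.1.1 l
/-- insertion 2 -/
def be2 (T : Matrix (Fin 4) (Fin 4) k) : Matrix V3 (Fin 4) k := Matrix.of fun x l =>
  T x.1.1 x.1.2 * (1 : Matrix (Fin 4) (Fin 4) k) x.2 l

omit [CharP k 2] in
lemma al1_kr (T m : Matrix (Fin 4) (Fin 4) k) : al1 T * ((m ⊗ₖ m) ⊗ₖ m) = m * al1 (m.transpose * (T * m)) := by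
  ext l ⟨⟨a, b⟩, c⟩
  simp only [Matrix.mul_apply, al1, Matrix.of_apply, Matrix.kroneckerMap_apply, Fintype.sum_prod_type, Matrix.one_apply,
    Matrix.transpose_apply]
  simp only [mul_ite, mul_one, mul_zero, ite_mul, zero_mul, Finset.sum_ite_eq, Finset.sum_ite_eq', Finset.mem_univ, if_true]
  simp only [Finset.mul_sum]
  refine Finset.sum_congr rfl fun i _ => Finset.sum_congr rfl fun j _ => by ring

omit [CharP k 2] in
lemma al2_kr (T m : Matrix (Fin 4) (Fin 4) k) : al2 T * ((m ⊗ₖ m) ⊗ₖ m) = m * al2 (m.transpose * (T * m)) := by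
  ext l ⟨⟨a, b⟩, c⟩
  simp only [Matrix.mul_apply, al2, Matrix.of_apply, Matrix.kroneckerMap_apply, Fintype.sum_prod_type, Matrix.one_apply,
    Matrix.transpose_apply]
  simp only [mul_ite, mul_one, mul_zero, ite_mul, zero_mul, Finset.sum_ite_eq, Finset.sum_ite_eq', Finset.mem_univ, if_true]
  simp only [Finset.mul_sum, Finset.sum_ite_irrel, Finset.sum_const_zero, Finset.sum_ite_eq, Finset.mem_univ, if_true]
  refine Finset.sum_congr rfl fun i _ => Finset.sum_congr rfl fun j _ => by ring

omit [CharP k 2] in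
lemma be1_kr (T m : Matrix (Fin 4) (Fin 4) k) : ((m ⊗ₖ m) ⊗ₖ m) * be1 T = be1 (m * (T * m.transpose)) * m := by
  ext ⟨⟨a, b⟩, c⟩ l
  simp only [Matrix.mul_apply, be1, Matrix.of_apply, Matrix.kroneckerMap_apply, Fintype.sum_prod_type, Matrix.one_apply,
    Matrix.transpose_apply]
  simp only [mul_ite, mul_one, mul_zero, ite_mul, zero_mul, Finset.sum_ite_eq, Finset.sum_ite_eq', Finset.mem_univ, if_true]
  simp only [Finset.mul_sum, Finset.sum_mul, Finset.sum_ite_irrel, Finset.sum_const_zero, Finset.sum_ite_eq, Finset.sum_ite_eq', Finset.mem_univ, if_true]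
  refine Finset.sum_congr rfl fun i _ => Finset.sum_congr rfl fun j _ => by ring

omit [CharP k 2] in
lemma be2_kr (T m : Matrix (Fin 4) (Fin 4) k) : ((m ⊗ₖ m) ⊗ₖ m) * be2 T = be2 (m * (T * m.transpose)) * m := by
  ext ⟨⟨a, b⟩, c⟩ l
  simp only [Matrix.mul_apply, be2, Matrix.of_apply, Matrix.kroneckerMap_apply, Fintype.sum_prod_type, Matrix.one_apply,
    Matrix.transpose_apply]
  simp only [mul_ite, mul_one, mul_zero, ite_mul, zero_mul, Finset.sum_ite_eq, Finset.sum_ite_eq', Finset.mem_univ, if_true]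
  simp only [Finset.mul_sum, Finset.sum_mul]
  refine Finset.sum_congr rfl fun i _ => Finset.sum_congr rfl fun j _ => by ring

lemma e0N_mat : (mat k 64 64 e0N).submatrix e3 e3 =
    be1 (TTi k 0) * al1 (TT k 0) + be2 (TTi k 0) * al2 (TT k 0) := by
  ext ⟨⟨a, b⟩, c⟩ ⟨⟨a', b'⟩, c'⟩
  rw [Matrix.submatrix_apply, e0N, ofFnN_mat]
  have h1 : Nat.div (e3 ((a, b), c) : Fin 64) 16 = a := by
    rw [e3_val]; change _ / 16 = _; simp only; omega
  have h2 : Nat.mod (Nat.div (e3 ((a, b), c) : Fin 64) 4) 4 = b := by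
    rw [e3_val]; change (_ / 4) % 4 = _; simp only; omega
  have h3 : Nat.mod (e3 ((a, b), c) : Fin 64) 4 = c := by
    rw [e3_val]; change _ % 4 = _; simp only; omega
  have h1' : Nat.div (e3 ((a', b'), c') : Fin 64) 16 = a' := by
    rw [e3_val]; change _ / 16 = _; simp only; omega
  have h2' : Nat.mod (Nat.div (e3 ((a', b'), c') : Fin 64) 4) 4 = b' := by
    rw [e3_val]; change (_ / 4) % 4 = _; simp only; omega
  have h3' : Nat.mod (e3 ((a', b'), c') : Fin 64) 4 = c' := by
    rw [e3_val]; change _ % 4 = _; simp only; omega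
  rw [h1, h2, h3, h1', h2', h3']
  simp only [Nat.mul_eq, Nat.add_eq, Nat.beq_eq]
  push_cast
  simp only [bn_cast]
  simp only [Matrix.add_apply, Matrix.mul_apply, al1, be1, al2, be2, Matrix.of_apply, Matrix.one_apply, TT, TTi, mat_apply]
  simp only [mul_ite, mul_one, mul_zero, ite_mul, zero_mul, Finset.sum_ite_eq, Finset.sum_ite_eq', Finset.mem_univ, if_true, one_mul,
    Fin.val_inj, Fin.val_zero]

end

section fam
variable {k G : Type} [Field k] [Group G]

lemma fam_MFac {P : FDRep k G → Prop} {ι κ Z : Type} [Fintype ι] [DecidableEq ι] [Fintype κ] [DecidableEq κ]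
    [Fintype Z] [DecidableEq Z] [MulAction G Z] (ρ : G →* Matrix ι ι k) (u : G →* Matrix κ κ k)
    (A : Z → Matrix ι κ k) (B : Z → Matrix κ ι k) (hA : ∀ g z, ρ g * A z = A (g • z) * u g)
    (hB : ∀ g z, B (g • z) * ρ g = u g * B z) (hP : Fac P (FM (kr (permM k G Z) u))) :
    MFac P ρ (∑ z, A z * B z) := by
  refine ⟨Z × κ, inferInstance, inferInstance, kr (permM k G Z) u, Matrix.of fun i x => A x.1 i x.2,
    Matrix.of fun x i => B x.1 x.2 i, hP, ?_, ?_, ?_⟩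
  · intro g
    ext i ⟨z, l⟩
    have := congrFun (congrFun (hA g z) i) l
    rw [Matrix.mul_apply] at this
    simp only [Matrix.mul_apply, Matrix.of_apply, kr_apply, Matrix.kroneckerMap_apply, Fintype.sum_prod_type, permM_apply]
    rw [this]
    simp [Matrix.mul_apply]
  · intro g
    ext ⟨z, l⟩ i
    have := congrFun (congrFun (hB g (g⁻¹ • z)) l) i
    rw [smul_inv_smul, Matrix.mul_apply] at this
    simp only [Matrix.mul_apply, Matrix.of_apply, kr_apply, Matrix.kroneckerMap_apply, Fintype.sum_prod_type, permM_apply]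
    rw [this]
    rw [Finset.sum_eq_single (g⁻¹ • z)]
    · simp [Matrix.mul_apply]
    · intro w _ hw
      have hne : ¬ z = g • w := fun h => hw (by rw [h, inv_smul_smul])
      simp [hne]
    · simp
  · ext i j
    simp [Matrix.mul_apply, Matrix.sum_apply, Fintype.sum_prod_type]

lemma tr_MFac {P : FDRep k G → Prop} {ι : Type} [Fintype ι] [DecidableEq ι] [Fintype G] [DecidableEq G]
    (ρ : G →* Matrix ι ι k) (θ : Matrix ι ι k) (b : ι) (hP : Fac P (FM (permM k G G))) :
    MFac P ρ (∑ g, Matrix.of fun i j => (ρ g * θ) i b * ρ g⁻¹ b j) := by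
  refine ⟨G, inferInstance, inferInstance, permM k G G, Matrix.of fun i g => (ρ g * θ) i b,
    Matrix.of fun g j => ρ g⁻¹ b j, hP, ?_, ?_, ?_⟩
  · intro g
    ext i h
    simp only [Matrix.mul_apply (N := permM k G G g), Matrix.mul_apply (M := ρ g), Matrix.of_apply, permM_apply]
    rw [show ∑ j, ρ g i j * (ρ h * θ) j b = (ρ g * (ρ h * θ)) i b from (Matrix.mul_apply).symm]
    rw [← mul_assoc, ← map_mul]
    simp
  · intro g
    ext h j
    simp only [Matrix.mul_apply, Matrix.of_apply, permM_apply]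
    rw [show ∑ l, ρ h⁻¹ b l * ρ g l j = (ρ h⁻¹ * ρ g) b j from (Matrix.mul_apply).symm, ← map_mul]
    rw [Finset.sum_eq_single (g⁻¹ * h)]
    · simp
    · intro w _ hw
      rw [if_neg (fun h => hw (by rw [h]; simp))]; simp
    · simp
  · ext i j
    simp [Matrix.mul_apply, Matrix.sum_apply]

lemma sum_trace {ι Z : Type} [Fintype ι] [DecidableEq ι] [Fintype G]
    [Fintype Z] [DecidableEq Z] [MulAction G Z] (ρ : G →* Matrix ι ι k) (θ : Matrix ι ι k)
    (f : Z → Matrix ι ι k) (hf : ∀ g z, f (g • z) = ρ g * f z * ρ g⁻¹) (z0 : Z)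
    (ht : ∀ z, ∃ g : G, g • z0 = z)
    (h0 : f z0 = ∑ g with (g • z0 = z0), ρ g * θ * ρ g⁻¹) : ∑ z, f z = ∑ g : G, ρ g * θ * ρ g⁻¹ := by
  rw [← Finset.sum_fiberwise Finset.univ (fun g : G => g • z0)]
  refine Finset.sum_congr rfl fun z _ => ?_
  obtain ⟨a, rfl⟩ := ht z
  rw [hf, h0, Finset.mul_sum, Finset.sum_mul]
  refine Finset.sum_bij (fun g _ => a * g) ?_ ?_ ?_ ?_
  · intro g hg; simp at hg ⊢; rw [mul_smul, hg]
  · intro g _ h _ e; exact mul_left_cancel e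
  · intro g hg
    refine ⟨a⁻¹ * g, ?_, by simp⟩
    simp at hg ⊢; rw [mul_smul, hg, inv_smul_smul]
  · intro g _; rw [mul_inv_rev, map_mul, map_mul]; noncomm_ring

end fam

end A7

open CategoryTheory CategoryTheory.MonoidalCategory
open AlgebraicModule

namespace A7
open scoped Kronecker

/-- distinct triples -/
abbrev Y3 : Type := {t : Tr // dist3 t}

instance : MulAction G7 Y3 where
  smul g z := ⟨(g.1 z.1.1, g.1 z.1.2.1, g.1 z.1.2.2), by
    obtain ⟨z, h1, h2, h3⟩ := z
    exact ⟨fun h => h1 (g.1.injective h), fun h => h2 (g.1.injective h), fun h => h3 (g.1.injective h)⟩⟩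
  one_smul z := rfl
  mul_smul g h z := rfl

lemma smul_Y3 (g : G7) (z : Y3) : (g • z).1 = (g.1 z.1.1, g.1 z.1.2.1, g.1 z.1.2.2) := rfl

/-- base point -/
def z0 : Y3 := ⟨(0, 1, 2), by decide⟩

lemma Y3_trans (z w : Y3) : ∃ g : G7, g • z = w := by
  have h5 := alternatingGroup.isMultiplyPretransitive (Fin 7)
  have h3 : MulAction.IsMultiplyPretransitive G7 (Fin 7) 3 :=
    MulAction.isMultiplyPretransitive_of_le (n := Nat.card (Fin 7) - 2) (by simp) (by simp)
  rw [MulAction.isMultiplyPretransitive_iff] at h3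
  have emb : ∀ z : Y3, Function.Injective ![z.1.1, z.1.2.1, z.1.2.2] := by
    rintro ⟨⟨a, b, c⟩, h1, h2, h3⟩
    simp only at h1 h2 h3
    intro i j hij
    fin_cases i <;> fin_cases j <;> simp_all [eq_comm]
  obtain ⟨g, hg⟩ := h3 ⟨_, emb z⟩ ⟨_, emb w⟩
  refine ⟨g, Subtype.ext ?_⟩
  have e := fun i => DFunLike.congr_fun hg i
  rw [smul_Y3]
  exact Prod.ext (e 0) (Prod.ext (e 1) (e 2))

lemma c3_smul (g : G7) (z : Y3) : c3 (g • z).1 = g * c3 z.1 * g⁻¹ := by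
  rw [c3, dif_pos (g • z).2, c3, dif_pos z.2]
  apply Subtype.ext
  change _ = g.1 * (_ * _) * g.1⁻¹
  simp only [smul_Y3]
  rw [Equiv.swap_apply_apply, Equiv.swap_apply_apply]
  group

lemma stab_card : (Finset.univ.filter fun g : G7 => g • z0 = z0).card = 12 := by
  have : Fintype (MulAction.orbit G7 z0) := Fintype.ofFinite _
  have h1 := MulAction.card_orbit_mul_card_stabilizer_eq_card_group G7 z0
  have h2 : MulAction.orbit G7 z0 = Set.univ := by
    ext w; simp only [Set.mem_univ, iff_true]; exact Y3_trans z0 w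
  have h3 : Fintype.card (MulAction.orbit G7 z0) = 210 := by
    rw [Fintype.card_congr (Equiv.setCongr h2), Fintype.card_congr (Equiv.Set.univ _)]
    decide +kernel
  rw [h3, card_alternatingGroup] at h1
  have h4 : (Finset.univ.filter fun g : G7 => g • z0 = z0).card = Fintype.card (MulAction.stabilizer G7 z0) := by
    rw [Fintype.card_subtype]; rfl
  rw [h4]
  simp [Nat.factorial] at h1
  simp
  omega

lemma stab_words : (Finset.univ.filter fun g : G7 => g • z0 = z0) = (hW.map wd).toFinset := by
  symm
  apply Finset.eq_of_subset_of_card_le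
  · intro g hg
    rw [List.mem_toFinset, List.mem_map] at hg
    obtain ⟨w, hw, rfl⟩ := hg
    simp only [Finset.mem_filter, Finset.mem_univ, true_and]
    revert w; decide +kernel
  · rw [stab_card, List.toFinset_card_of_nodup]
    · decide +kernel
    · decide +kernel

/-- generators, totalised by zero -/
def mN (a b c : ℕ) : ℕ := if a ≠ b ∧ b ≠ c ∧ a ≠ c then
  mulN 4 4 4 (Nat.xor (TiN a) (TiN b)) (Nat.xor (TN b) (TN c)) else 0

lemma mN_sum : xsum 7 (fun a => xsum 7 fun b => xsum 7 fun c => mN a b c) = oneN 4 := by decide +kernel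

variable {k : Type} [Field k] [CharP k 2]

lemma c_sum : ∑ z : Y3, phi k (c3 z.1) = 1 := by
  have h1 : ∀ z : Y3, phi k (c3 z.1) = mat k 4 4 (mN z.1.1 z.1.2.1 z.1.2.2) := by
    rintro ⟨⟨a, b, c⟩, h⟩
    rw [phi_c3, m3N, if_pos h, mN, if_pos]
    obtain ⟨h1, h2, h3⟩ := h
    exact ⟨fun e => h1 (Fin.ext e), fun e => h2 (Fin.ext e), fun e => h3 (Fin.ext e)⟩
  have h2 : ∑ z : Y3, phi k (c3 z.1) = ∑ t : Tr, mat k 4 4 (mN t.1 t.2.1 t.2.2) := by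
    rw [Finset.sum_congr rfl fun z _ => h1 z]
    rw [← Finset.sum_subtype (p := dist3) (s := Finset.univ.filter dist3) (by simp)
      (f := fun t : Tr => mat k 4 4 (mN t.1 t.2.1 t.2.2))]
    rw [Finset.sum_filter_of_ne]
    rintro ⟨a, b, c⟩ _ h
    by_contra h3
    apply h
    rw [mN, if_neg, mat_zero]
    rintro ⟨h4, h5, h6⟩
    exact h3 ⟨fun e => h4 (congrArg _ e), fun e => h5 (congrArg _ e), fun e => h6 (congrArg _ e)⟩
  rw [h2, ← mat_oneN k 4, ← mN_sum]
  simp only [mat_xsum, Fintype.sum_prod_type, Finset.sum_range]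

/-- the triple tensor power -/
noncomputable abbrev rho3 (k : Type) [Field k] [CharP k 2] : G7 →* Matrix V3 V3 k := kr (kr (phi k) (phi k)) (phi k)

lemma rho3_apply (g : G7) : rho3 k g = (phi k g ⊗ₖ phi k g) ⊗ₖ phi k g := rfl

lemma phi_inv_mul (g : G7) : phi k g⁻¹ * phi k g = 1 := by rw [← map_mul]; simp
lemma phi_mul_inv (g : G7) : phi k g * phi k g⁻¹ = 1 := by rw [← map_mul]; simp

lemma rel_phi' (g : G7) (i : Fin 7) : phi k g * (TTi k i * (phi k g).transpose) = TTi k (g.1 i) := by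
  have h := rel_phi (k := k) g i
  have h1 : (phi k g * (TTi k i * (phi k g).transpose)) * TT k (g.1 i) * (phi k g * phi k g⁻¹) = 1 := by
    calc _ = phi k g * (TTi k i * ((phi k g).transpose * (TT k (g.1 i) * phi k g))) * phi k g⁻¹ := by noncomm_ring
      _ = 1 := by rw [h, TTi_TT, mul_one, phi_mul_inv]
  rw [phi_mul_inv, mul_one] at h1
  calc _ = (phi k g * (TTi k i * (phi k g).transpose)) * (TT k (g.1 i) * TTi k (g.1 i)) := by rw [TT_TTi, mul_one]
    _ = _ := by rw [← mul_assoc, h1, one_mul]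

/-- the twist -/
noncomputable def cz (k : Type) [Field k] [CharP k 2] (z : Y3) : Matrix V3 V3 k := (phi k (c3 z.1) ⊗ₖ (1 : Matrix (Fin 4) (Fin 4) k)) ⊗ₖ (1 : Matrix (Fin 4) (Fin 4) k)

lemma cz_smul (g : G7) (z : Y3) : rho3 k g * cz k z = cz k (g • z) * rho3 k g := by
  rw [cz, cz, rho3_apply, ← Matrix.mul_kronecker_mul, ← Matrix.mul_kronecker_mul, ← Matrix.mul_kronecker_mul,
    ← Matrix.mul_kronecker_mul, c3_smul, ← map_mul, ← map_mul]
  simp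

lemma cz_sum : ∑ z, cz k z = 1 := by
  have h := c_sum (k := k)
  ext ⟨⟨a, b⟩, c⟩ ⟨⟨a', b'⟩, c'⟩
  have h1 := congrFun (congrFun h a) a'
  simp only [Matrix.sum_apply, cz, Matrix.kroneckerMap_apply] at h1 ⊢
  rw [← Finset.sum_mul, ← Finset.sum_mul, h1]
  simp only [Matrix.one_apply, Prod.ext_iff]
  by_cases h1 : a = a' <;> by_cases h2 : b = b' <;> by_cases h3 : c = c' <;> simp [h1, h2, h3]

lemma al1_smul (g : G7) (z : Y3) : al1 (TT k (g • z).1.1) * rho3 k g = phi k g * al1 (TT k z.1.1) := by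
  rw [rho3_apply, al1_kr, smul_Y3]
  rw [rel_phi g]
lemma al2_smul (g : G7) (z : Y3) : al2 (TT k (g • z).1.1) * rho3 k g = phi k g * al2 (TT k z.1.1) := by
  rw [rho3_apply, al2_kr, smul_Y3]
  rw [rel_phi g]
lemma be1_smul (g : G7) (z : Y3) : rho3 k g * be1 (TTi k z.1.1) = be1 (TTi k (g • z).1.1) * phi k g := by
  rw [rho3_apply, be1_kr, smul_Y3, rel_phi']
lemma be2_smul (g : G7) (z : Y3) : rho3 k g * be2 (TTi k z.1.1) = be2 (TTi k (g • z).1.1) * phi k g := by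
  rw [rho3_apply, be2_kr, smul_Y3, rel_phi']

/-- projection family -/
noncomputable def ez (k : Type) [Field k] [CharP k 2] (z : Y3) : Matrix V3 V3 k :=
  be1 (TTi k z.1.1) * al1 (TT k z.1.1) + be2 (TTi k z.1.1) * al2 (TT k z.1.1)

lemma ez_smul (g : G7) (z : Y3) : rho3 k g * ez k z = ez k (g • z) * rho3 k g := by
  rw [ez, ez, mul_add, add_mul, ← Matrix.mul_assoc, ← Matrix.mul_assoc, be1_smul, be2_smul, Matrix.mul_assoc, Matrix.mul_assoc,
    ← al1_smul, ← al2_smul, Matrix.mul_assoc, Matrix.mul_assoc]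

lemma rho3_wd (w : List Tr) : rho3 k (wd w) = (mat k 64 64 (k3N (um w) (um w) (um w))).submatrix e3 e3 := by
  rw [k3N_mat, rho3_apply, phi_wd]

lemma wd_iw (w : List Tr) : wd (iw w) = (wd w)⁻¹ := by
  induction w with
  | nil => simp [iw, wd_nil]
  | cons t w ih =>
    have : iw (t :: w) = iw w ++ [(t.2.2, t.2.1, t.1)] := by simp [iw]
    rw [this, wd_append, wd_cons, wd_cons, wd_nil, ih, mul_inv_rev, c3_inv, mul_one]

/-- the trace certificate -/
noncomputable def thM (k : Type) [Field k] [CharP k 2] : Matrix V3 V3 k := (mat k 64 64 thN).submatrix e3 e3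

lemma mat_foldr (n m : ℕ) (l : List ℕ) : mat k n m (l.foldr Nat.xor 0) = (l.map (mat k n m)).sum := by
  induction l with
  | nil => simp [mat_zero]
  | cons a l ih => simp only [List.foldr_cons, List.map_cons, List.sum_cons, mat_xor, ih]

lemma sub_sum {n : ℕ} {ι : Type} (e : ι ≃ Fin n) (l : List (Matrix (Fin n) (Fin n) k)) :
    l.sum.submatrix e e = (l.map fun M => M.submatrix e e).sum := by
  induction l with
  | nil => rfl
  | cons a l ih => simp only [List.sum_cons, List.map_cons, ← ih]; rfl

lemma base_eq : cz k z0 * (1 - ez k z0) = ∑ g with (g • z0 = z0), rho3 k g * thM k * rho3 k g⁻¹ := by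
  rw [stab_words, List.sum_toFinset _ (by decide +kernel), List.map_map]
  have h1 := congrArg (fun M => (mat k 64 64 M).submatrix e3 e3) th_check
  rw [mat_foldr, sub_sum, List.map_map, List.map_map] at h1
  rw [← mulN_mat, ← Matrix.submatrix_mul_equiv _ _ e3 e3 e3, k3N_mat, mat_xor, mat_oneN, mat_oneN, Matrix.submatrix_add,
    Pi.add_apply, Pi.add_apply, e0N_mat, Matrix.submatrix_one_equiv, ← phi_c3] at h1
  have h2 : (1 : Matrix V3 V3 k) - ez k z0 = 1 + ez k z0 := by
    ext i j
    rw [Matrix.sub_apply, Matrix.add_apply]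
    exact CharTwo.sub_eq_add _ _
  rw [h2]
  refine Eq.trans h1.symm ?_
  congr 1
  apply List.map_congr_left
  intro w _
  simp only [Function.comp]
  rw [← wd_iw, rho3_wd, rho3_wd, thM, mul_assoc, Matrix.submatrix_mul_equiv, Matrix.submatrix_mul_equiv, mulN_mat, mulN_mat]

lemma id_sum : (∑ z : Y3, (cz k z * be1 (TTi k z.1.1)) * al1 (TT k z.1.1)) +
    (∑ z : Y3, (cz k z * be2 (TTi k z.1.1)) * al2 (TT k z.1.1)) +
    ∑ g : G7, rho3 k g * thM k * rho3 k g⁻¹ = 1 := by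
  rw [← sum_trace (rho3 k) (thM k) (fun z : Y3 => cz k z * (1 - ez k z)) ?_ z0 (Y3_trans z0) base_eq,
    ← Finset.sum_add_distrib, ← Finset.sum_add_distrib, ← cz_sum]
  · refine Finset.sum_congr rfl fun z _ => ?_
    rw [Matrix.mul_assoc, Matrix.mul_assoc, ← Matrix.mul_add, ← Matrix.mul_add, ez]
    rw [add_sub_cancel, cz_sum, mul_one]
  · intro g z
    have h : rho3 k g * rho3 k g⁻¹ = 1 := by rw [← map_mul]; simp
    have h1 := cz_smul (k := k) g z
    have h2 := ez_smul (k := k) g z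
    calc cz k (g • z) * (1 - ez k (g • z)) = cz k (g • z) * (1 - ez k (g • z)) * (rho3 k g * rho3 k g⁻¹) := by rw [h, mul_one]
      _ = cz k (g • z) * (rho3 k g - ez k (g • z) * rho3 k g) * rho3 k g⁻¹ := by noncomm_ring
      _ = cz k (g • z) * rho3 k g * (1 - ez k z) * rho3 k g⁻¹ := by rw [← h2]; noncomm_ring
      _ = _ := by rw [← h1]; noncomm_ring

/-- the natural module -/
noncomputable abbrev UU (k : Type) [Field k] [CharP k 2] : FDRep k G7 := FM (phi k)

lemma fac_perm (Z : Type) [Fintype Z] [DecidableEq Z] [MulAction G7 Z] :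
    Fac (PC (UU k)) (FM (permM k G7 Z)) :=
  Fac.iso (Fac.of ⟨Z, inferInstance, inferInstance, inferInstance, 0, by omega, rfl⟩) (ρ_ _).symm

lemma fac_permU (Z : Type) [Fintype Z] [DecidableEq Z] [MulAction G7 Z] :
    Fac (PC (UU k)) (FM (kr (permM k G7 Z) (phi k))) :=
  Fac.iso (Fac.of ⟨Z, inferInstance, inferInstance, inferInstance, 1, by omega, rfl⟩)
    ((tensorFM _ _).symm ≪≫ whiskerLeftIso _ (λ_ _).symm)

theorem fac3 : Fac (PC (UU k)) (Epow (UU k) 3) := by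
  have key : Fac (PC (UU k)) (FM (rho3 k)) := by
    refine fac_of_MFac (Bool ⊕ V3) (fun w => match w with
      | .inl true => ∑ z : Y3, (cz k z * be1 (TTi k z.1.1)) * al1 (TT k z.1.1)
      | .inl false => ∑ z : Y3, (cz k z * be2 (TTi k z.1.1)) * al2 (TT k z.1.1)
      | .inr b => ∑ g : G7, Matrix.of fun i j => (rho3 k g * thM k) i b * rho3 k g⁻¹ b j) ?_ ?_
    · rintro ((_ | _) | b)
      · refine fam_MFac (rho3 k) (phi k) _ _ ?_ al2_smul (fac_permU Y3)
        intro g z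
        rw [← Matrix.mul_assoc, cz_smul, Matrix.mul_assoc, be2_smul, Matrix.mul_assoc]
      · refine fam_MFac (rho3 k) (phi k) _ _ ?_ al1_smul (fac_permU Y3)
        intro g z
        rw [← Matrix.mul_assoc, cz_smul, Matrix.mul_assoc, be1_smul, Matrix.mul_assoc]
      · exact tr_MFac (rho3 k) (thM k) b (fac_perm G7)
    · rw [Fintype.sum_sum_type, Fintype.sum_bool]
      refine Eq.trans ?_ (id_sum (k := k))
      congr 1
      rw [Finset.sum_comm]
      refine Finset.sum_congr rfl fun g _ => ?_
      ext i j
      rw [Matrix.sum_apply, Matrix.mul_apply]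
      rfl
  refine key.iso ?_
  exact whiskerRightIso (whiskerRightIso (λ_ _) _ ≪≫ tensorFM _ _) _ ≪≫ tensorFM _ _

end A7

open CategoryTheory CategoryTheory.MonoidalCategory
open AlgebraicModule

namespace A7

section cls

lemma simple_of_ann {A : Type*} [Ring A] {M : Type*} [AddCommGroup M] [Module A M]
    [IsSimpleModule A M] {J : Type*} [Finite J] (S : J → Type*) [∀ j, AddCommGroup (S j)]
    [∀ j, Module A (S j)] [∀ j, IsSimpleModule A (S j)] (x : ∀ j, S j)
    (h : ∀ a : A, a • x = 0 → ∀ m : M, a • m = 0) : ∃ j, Nonempty (S j ≃ₗ[A] M) := by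
  classical
  have : Nontrivial M := IsSimpleModule.nontrivial A M
  obtain ⟨m, hm⟩ := exists_ne (0 : M)
  let F := LinearMap.toSpanSingleton A (∀ j, S j) x
  let H := LinearMap.toSpanSingleton A M m
  have hle : LinearMap.ker F ≤ LinearMap.ker H := by
    intro a ha
    rw [LinearMap.mem_ker, LinearMap.toSpanSingleton_apply] at ha ⊢
    exact h a ha m
  obtain ⟨g, hg⟩ := IsSemisimpleModule.extension_property (R := A) (LinearMap.range F).subtype
    (Submodule.subtype_injective _) (LinearMap.id)
  let q : (∀ j, S j) →ₗ[A] M :=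
    ((LinearMap.ker F).liftQ H hle) ∘ₗ (F.quotKerEquivRange.symm.toLinearMap) ∘ₗ g
  have hq : q ≠ 0 := by
    intro h0
    have h1 : q (F 1) = 0 := by rw [h0]; rfl
    have h2 : g (F 1) = ⟨F 1, LinearMap.mem_range_self F 1⟩ :=
      LinearMap.congr_fun hg ⟨F 1, LinearMap.mem_range_self F 1⟩
    have h3 : F.quotKerEquivRange.symm ⟨F 1, LinearMap.mem_range_self F 1⟩
        = Submodule.Quotient.mk 1 := by
      rw [LinearEquiv.symm_apply_eq]; rfl
    simp only [q, LinearMap.comp_apply, h2, LinearEquiv.coe_coe, h3] at h1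
    apply hm
    have h4 : H 1 = 0 := h1
    simpa [H] using h4
  obtain ⟨j, hj⟩ : ∃ j, q ∘ₗ LinearMap.single A S j ≠ 0 := by
    by_contra! hc
    have := Fintype.ofFinite J
    exact hq (LinearMap.pi_ext' fun j => by rw [hc j]; rfl)
  exact ⟨j, ⟨LinearEquiv.ofBijective _ ((LinearMap.bijective_or_eq_zero _).resolve_right hj)⟩⟩

lemma smul_zero_of_trace {K A V : Type*} [Field K] [IsAlgClosed K] [Ring A] [Algebra K A]
    [AddCommGroup V] [Module K V] [Module A V] [IsScalarTower K A V] [IsSimpleModule A V]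
    [FiniteDimensional K V] (e : A)
    (h : ∀ b : A, LinearMap.trace K V (Algebra.lsmul K K V (b * e)) = 0) (o : V) : e • o = 0 := by
  have hS := IsSimpleModule.algebraMap_end_bijective_of_isAlgClosed (A := A) (V := V) K
  by_contra hv
  obtain ⟨f, hf⟩ := Module.Projective.exists_dual_ne_zero K hv
  let r : V →ₗ[K] V := (f.smulRight o)
  let r' : Module.End (Module.End A V) V :=
    { toFun := r
      map_add' := r.map_add
      map_smul' := by
        intro c y
        obtain ⟨t, rfl⟩ := hS.2 c
        simp }
  obtain ⟨s, hs⟩ := Module.Finite.fg_top (R := K) (M := V)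
  obtain ⟨b, hb⟩ := jacobson_density (R := A) r' s
  have hb' : (Algebra.lsmul K K V b : V →ₗ[K] V) = r := by
    apply LinearMap.ext_on (s := (s : Set V)) hs
    intro y hy
    exact (hb y hy).symm
  have h0 := h b
  have h1 : (Algebra.lsmul K K V (b * e) : V →ₗ[K] V) =
      (f ∘ₗ (Algebra.lsmul K K V e : V →ₗ[K] V)).smulRight o := by
    rw [map_mul, hb']
    apply LinearMap.ext
    intro y
    rfl
  rw [h1, LinearMap.trace_smulRight] at h0
  exact hf h0

/-- trace criterion for nilpotence -/
lemma nilp_of_trace {K A : Type*} [Field K] [IsAlgClosed K] [Ring A] [Algebra K A]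
    [FiniteDimensional K A] (e : A)
    (h : ∀ (m : Ideal A), m.IsMaximal → ∀ b : A,
      LinearMap.trace K (A ⧸ m) (Algebra.lsmul K K (A ⧸ m) (b * e)) = 0) : IsNilpotent e := by
  have : IsArtinianRing A := IsArtinianRing.of_finite K A
  have key : e ∈ Ideal.jacobson (⊥ : Ideal A) := by
    rw [Ideal.jacobson_bot, Ring.jacobson_eq_sInf_isMaximal, Ideal.mem_sInf]
    intro m hm
    have hm : m.IsMaximal := hm
    have : IsSimpleModule A (A ⧸ m) := isSimpleModule_iff_isCoatom.2 hm.out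
    have := smul_zero_of_trace (K := K) (V := A ⧸ m) e (h m hm) (Submodule.Quotient.mk 1)
    rwa [← Submodule.Quotient.mk_smul, smul_eq_mul, mul_one, Submodule.Quotient.mk_eq_zero] at this
  obtain ⟨n, hn⟩ := IsArtinianRing.isNilpotent_jacobson_bot (R := A)
  exact ⟨n, by
    have := Ideal.pow_mem_pow key n
    rw [hn] at this
    simpa using this⟩

end cls
end A7

open CategoryTheory CategoryTheory.MonoidalCategory
open AlgebraicModule

namespace A7

section cls2
open scoped Matrix
variable {k G : Type} [Field k] [Group G] [Finite G]

omit [Finite G] in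
lemma simple_asModule (M : FDRep k G) (hM : Simple M) :
    IsSimpleModule (MonoidAlgebra k G) (Representation.asModule M.ρ) := by
  rw [← Representation.irreducible_iff_isSimpleModule_asModule]
  have hnz : ¬ Limits.IsZero M := Simple.not_isZero M
  refine { exists_pair_ne := ⟨⊥, ⊤, ?_⟩, eq_bot_or_eq_top := ?_ }
  · intro h
    apply hnz
    rw [Limits.IsZero.iff_id_eq_zero]
    apply lin_ext
    ext x
    have hx : x ∈ (⊤ : Subrepresentation M.ρ).toSubmodule := Submodule.mem_top
    rw [← h] at hx
    exact hx
  · intro σ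
    let N : FDRep k G := FDRep.of (V := σ.toSubmodule) σ.toRepresentation
    let i : N ⟶ M := mkHom N M σ.toSubmodule.subtype (fun g => by ext x; rfl)
    have hm : Mono i := by
      constructor
      intro Z f g hfg
      apply lin_ext
      ext z
      have := LinearMap.congr_fun (congrArg lin hfg) z
      exact this
    by_cases h0 : i = 0
    · left
      apply Subrepresentation.toSubmodule_injective
      change σ.toSubmodule = ⊥
      rw [eq_bot_iff]
      intro x hx
      have := LinearMap.congr_fun (congrArg lin h0) ⟨x, hx⟩
      exact this
    · right
      have hi : IsIso i := isIso_of_mono_of_nonzero h0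
      apply Subrepresentation.toSubmodule_injective
      change σ.toSubmodule = ⊤
      rw [eq_top_iff]
      intro x _
      have := LinearMap.congr_fun (congrArg lin (IsIso.inv_hom_id i)) x
      have h2 : (lin i) (lin (inv i) x) = x := this
      rw [← h2]
      exact (lin (inv i) x).2

variable {ι : Type} [Fintype ι] (n : ι → ℕ)
  (ρ : ∀ i, G →* Matrix (Fin (n i)) (Fin (n i)) k) (p : ∀ i, Matrix (Fin (n i)) (Fin (n i)) k)

/-- evaluation of the group algebra on a matrix representation -/
noncomputable def ev {m : ℕ} (ρ : G →* Matrix (Fin m) (Fin m) k) :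
    MonoidAlgebra k G →ₐ[k] Matrix (Fin m) (Fin m) k := MonoidAlgebra.lift k _ G ρ

omit [Finite G] in
lemma ev_single {m : ℕ} (ρ : G →* Matrix (Fin m) (Fin m) k) (g : G) (c : k) :
    ev ρ (MonoidAlgebra.single g c) = c • ρ g := by
  simp [ev]

lemma nilp_of_ev (ht : ∀ (V : Type) [AddCommGroup V] [Module (AlgebraicClosure k) V]
      [FiniteDimensional (AlgebraicClosure k) V] (T : G →* Module.End (AlgebraicClosure k) V),
      ∃ a : ι → AlgebraicClosure k, ∀ g, LinearMap.trace _ V (T g) =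
        ∑ i, a i * algebraMap k _ (Matrix.trace (ρ i g * p i)))
    (e : MonoidAlgebra k G) (he : ∀ i, ev (ρ i) e * p i = 0) : IsNilpotent e := by
  let K := AlgebraicClosure k
  let f : MonoidAlgebra k G →+* MonoidAlgebra K G := MonoidAlgebra.mapRingHom G (algebraMap k K)
  have hf : Function.Injective f := by
    intro x y hxy
    ext g
    have := congrArg (fun z : MonoidAlgebra K G => z.coeff g) hxy
    simpa [f] using this
  have : IsNilpotent (f e) := by
    have : FiniteDimensional K (MonoidAlgebra K G) := inferInstance
    apply nilp_of_trace (K := K)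
    intro m hm b
    obtain ⟨a, ha⟩ := ht (MonoidAlgebra K G ⧸ m)
      ((Algebra.lsmul K K (A := MonoidAlgebra K G) (MonoidAlgebra K G ⧸ m)).toMonoidHom.comp
        (MonoidAlgebra.of K G))
    have h1 : ∀ x : MonoidAlgebra k G,
        LinearMap.trace K _ (Algebra.lsmul K K (MonoidAlgebra K G ⧸ m) (f x)) =
        ∑ i, a i * algebraMap k K (Matrix.trace (ev (ρ i) x * p i)) := by
      intro x
      induction x using MonoidAlgebra.induction_linear with
      | zero => simp
      | add x y hx hy =>
        rw [map_add, map_add, map_add, hx, hy, ← Finset.sum_add_distrib]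
        apply Finset.sum_congr rfl
        intro i _
        rw [map_add, add_mul, Matrix.trace_add, map_add, mul_add]
      | single g c =>
        have h2 : f (MonoidAlgebra.single g c) = algebraMap k K c • MonoidAlgebra.of K G g := by
          simp [f, Algebra.algebraMap_eq_smul_one]
        rw [h2, map_smul, map_smul]
        have h3 := ha g
        rw [MonoidHom.comp_apply] at h3
        rw [show LinearMap.trace K _ (Algebra.lsmul K K (MonoidAlgebra K G ⧸ m)
          (MonoidAlgebra.of K G g)) = _ from h3, smul_eq_mul, Finset.mul_sum]
        apply Finset.sum_congr rfl
        intro i _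
        rw [ev_single, Matrix.smul_mul, Matrix.trace_smul, smul_eq_mul, map_mul]
        ring
    induction b using MonoidAlgebra.induction_linear with
    | zero => simp
    | add x y hx hy => rw [add_mul, map_add, map_add, hx, hy, add_zero]
    | single g c =>
      have h2 : MonoidAlgebra.single g c * f e = c • f (MonoidAlgebra.of k G g * e) := by
        rw [map_mul, ← smul_mul_assoc]
        simp [f]
      rw [h2, map_smul, map_smul, h1, Finset.sum_eq_zero, smul_zero]
      intro i _
      rw [map_mul, Matrix.mul_assoc, he i]
      simp
  obtain ⟨N, hN⟩ := this
  exact ⟨N, hf (by rw [map_pow, hN, map_zero])⟩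

/-- representation attached to a matrix representation -/
noncomputable abbrev rp {m : ℕ} (ρ : G →* Matrix (Fin m) (Fin m) k) :
    Representation k G (Fin m → k) := (FM ρ).ρ

omit [Finite G] in
lemma rp_smul {m : ℕ} (ρ : G →* Matrix (Fin m) (Fin m) k) (a : MonoidAlgebra k G)
    (x : Fin m → k) : (rp ρ).asModuleEquiv (a • (rp ρ).asModuleEquiv.symm x) =
      ev ρ a *ᵥ x := by
  rw [Representation.asModuleEquiv_map_smul, LinearEquiv.apply_symm_apply]
  induction a using MonoidAlgebra.induction_linear with
  | zero => simp
  | add a b ha hb => rw [map_add, map_add, LinearMap.add_apply, ha, hb, Matrix.add_mulVec]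
  | single g c =>
    rw [ev_single, Representation.asAlgebraHom_single, Matrix.smul_mulVec]
    rfl

/-- the image of an idempotent -/
noncomputable def piece {m : ℕ} (ρ : G →* Matrix (Fin m) (Fin m) k)
    (p : Matrix (Fin m) (Fin m) k) (hc : ∀ g, p * ρ g = ρ g * p) : Subrepresentation (rp ρ) where
  toSubmodule := LinearMap.ker (Matrix.toLin' p - LinearMap.id)
  apply_mem_toSubmodule := by
    intro g v hv
    rw [LinearMap.mem_ker, LinearMap.sub_apply, LinearMap.id_apply, Matrix.toLin'_apply,
      sub_eq_zero] at hv ⊢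
    change p *ᵥ (ρ g *ᵥ v) = ρ g *ᵥ v
    rw [Matrix.mulVec_mulVec, hc, ← Matrix.mulVec_mulVec, hv]

omit [Finite G] in
lemma mem_piece {m : ℕ} (ρ : G →* Matrix (Fin m) (Fin m) k)
    (p : Matrix (Fin m) (Fin m) k) (hc : ∀ g, p * ρ g = ρ g * p) (x : Fin m → k) :
    x ∈ (piece ρ p hc).toSubmodule ↔ p *ᵥ x = x := by
  change x ∈ LinearMap.ker (Matrix.toLin' p - LinearMap.id) ↔ _
  rw [LinearMap.mem_ker, LinearMap.sub_apply, LinearMap.id_apply, Matrix.toLin'_apply,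
      sub_eq_zero]

omit [Finite G] in
lemma span_ev {m : ℕ} (ρ : G →* Matrix (Fin m) (Fin m) k) (x z : Fin m → k)
    (hz : z ∈ Submodule.span k (Set.range fun g => ρ g *ᵥ x)) :
    ∃ a : MonoidAlgebra k G, ev ρ a *ᵥ x = z := by
    induction hz using Submodule.span_induction with
    | mem z hz =>
      obtain ⟨g, rfl⟩ := hz
      exact ⟨MonoidAlgebra.single g 1, by rw [ev_single, one_smul]⟩
    | zero => exact ⟨0, by simp⟩
    | add u v _ _ hu hv =>
      obtain ⟨a, rfl⟩ := hu
      obtain ⟨b, rfl⟩ := hv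
      exact ⟨a + b, by rw [map_add, Matrix.add_mulVec]⟩
    | smul c u _ hu =>
      obtain ⟨a, rfl⟩ := hu
      exact ⟨c • a, by rw [map_smul, Matrix.smul_mulVec]⟩

omit [Finite G] in
lemma ev_comm {m : ℕ} (ρ : G →* Matrix (Fin m) (Fin m) k)
    (p : Matrix (Fin m) (Fin m) k) (hc : ∀ g, p * ρ g = ρ g * p) (a : MonoidAlgebra k G)
    (x : Fin m → k) : p *ᵥ (ev ρ a *ᵥ x) = ev ρ a *ᵥ (p *ᵥ x) := by
  rw [Matrix.mulVec_mulVec, Matrix.mulVec_mulVec]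
  congr 1
  induction a using MonoidAlgebra.induction_linear with
  | zero => simp
  | add a b ha hb => rw [map_add, mul_add, add_mul, ha, hb]
  | single g c => rw [ev_single, Matrix.mul_smul, Matrix.smul_mul, hc]

omit [Finite G] in
lemma piece_simple {m : ℕ} (ρ : G →* Matrix (Fin m) (Fin m) k)
    (p : Matrix (Fin m) (Fin m) k) (hc : ∀ g, p * ρ g = ρ g * p) (hp : p * p = p) (hp0 : p ≠ 0)
    (hs : ∀ x y : Fin m → k, p *ᵥ x = x → x ≠ 0 → p *ᵥ y = y →
      y ∈ Submodule.span k (Set.range fun g => ρ g *ᵥ x)) :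
    IsSimpleModule (MonoidAlgebra k G) (piece ρ p hc).asSubmodule := by
  rw [isSimpleModule_iff_toSpanSingleton_surjective]
  constructor
  · by_contra hn
    rw [not_nontrivial_iff_subsingleton] at hn
    apply hp0
    have : ∀ x, p *ᵥ x = 0 := by
      intro x
      have h1 : p *ᵥ x ∈ (piece ρ p hc).toSubmodule := by
        rw [mem_piece, Matrix.mulVec_mulVec, hp]
      have := hn.elim ⟨p *ᵥ x, h1⟩ 0
      exact congrArg Subtype.val this
    apply Matrix.toLin'.injective
    apply LinearMap.ext
    intro x
    rw [Matrix.toLin'_apply, this]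
    simp
  · rintro ⟨x, hx⟩ hx0 ⟨y, hy⟩
    have hx1 := (mem_piece ρ p hc x).1 hx
    have hy1 := (mem_piece ρ p hc y).1 hy
    have hx2 : x ≠ 0 := fun h => hx0 (Subtype.ext h)
    obtain ⟨a, ha⟩ := span_ev ρ x y (hs x y hx1 hx2 hy1)
    refine ⟨a, Subtype.ext ?_⟩
    rw [LinearMap.toSpanSingleton_apply]
    have := rp_smul ρ a x
    exact this.trans ha

theorem classify (hc : ∀ i g, p i * ρ i g = ρ i g * p i) (hp : ∀ i, p i * p i = p i)
    (hp0 : ∀ i, p i ≠ 0)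
    (hs : ∀ i (x y : Fin (n i) → k), p i *ᵥ x = x → x ≠ 0 → p i *ᵥ y = y →
      y ∈ Submodule.span k (Set.range fun g => ρ i g *ᵥ x))
    (ht : ∀ (V : Type) [AddCommGroup V] [Module (AlgebraicClosure k) V]
      [FiniteDimensional (AlgebraicClosure k) V] (T : G →* Module.End (AlgebraicClosure k) V),
      ∃ a : ι → AlgebraicClosure k, ∀ g, LinearMap.trace _ V (T g) =
        ∑ i, a i * algebraMap k _ (Matrix.trace (ρ i g * p i)))
    (M : FDRep k G) (hM : Simple M) : ∃ i, IsSummand M (FM (ρ i)) := by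
  have hMs := simple_asModule M hM
  have hSs := fun i => piece_simple (ρ i) (p i) (hc i) (hp i) (hp0 i) (hs i)
  have hmem : ∀ i (x : Fin (n i) → k), p i *ᵥ x ∈ (piece (ρ i) (p i) (hc i)).asSubmodule := by
    intro i x
    change p i *ᵥ x ∈ (piece (ρ i) (p i) (hc i)).toSubmodule
    rw [mem_piece, Matrix.mulVec_mulVec, hp]
  obtain ⟨⟨i, b⟩, ⟨φ⟩⟩ := simple_of_ann (A := MonoidAlgebra k G) (M := Representation.asModule M.ρ)
    (J := Σ i, Fin (n i)) (fun j => (piece (ρ j.1) (p j.1) (hc j.1)).asSubmodule)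
    (fun j => ⟨p j.1 *ᵥ Pi.single j.2 1, hmem j.1 _⟩) (by
      have kill : ∀ e : MonoidAlgebra k G, (∀ i, ev (ρ i) e * p i = 0) →
          ∀ m : Representation.asModule M.ρ, e • m = 0 := by
        intro e he m
        by_contra hne
        obtain ⟨a, ha⟩ := IsSimpleModule.toSpanSingleton_surjective (MonoidAlgebra k G) hne m
        rw [LinearMap.toSpanSingleton_apply, smul_smul] at ha
        obtain ⟨N, hN⟩ := nilp_of_ev n ρ p ht (a * e) (fun i => by
          rw [map_mul, Matrix.mul_assoc, he i, Matrix.mul_zero])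
        have hpow : ∀ N : ℕ, (a * e) ^ N • m = m := by
          intro N
          induction N with
          | zero => simp
          | succ N ih => rw [pow_succ, mul_smul, ha, ih]
        have h0 := hpow N
        rw [hN, zero_smul] at h0
        exact hne (by rw [← h0, smul_zero])
      intro a ha
      apply kill
      intro i
      apply Matrix.toLin'.injective
      apply LinearMap.pi_ext'
      intro b
      ext1
      have h1 := congrArg Subtype.val (congrFun ha ⟨i, b⟩)
      have h2 := rp_smul (ρ i) a (p i *ᵥ Pi.single b 1)
      have h3 : ev (ρ i) a *ᵥ (p i *ᵥ Pi.single b 1) = 0 := h2.symm.trans h1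
      simpa using h3)
  refine ⟨i, ?_⟩
  let S := (piece (ρ i) (p i) (hc i)).asSubmodule
  let α : Representation.asModule M.ρ →ₗ[MonoidAlgebra k G] Representation.asModule (rp (ρ i)) :=
    S.subtype ∘ₗ φ.symm.toLinearMap
  let pl : Representation.asModule (rp (ρ i)) →ₗ[MonoidAlgebra k G] S :=
    { toFun := fun x => ⟨p i *ᵥ x, hmem i x⟩
      map_add' := fun x y => Subtype.ext (Matrix.mulVec_add (p i) x y)
      map_smul' := fun a x => Subtype.ext (by
        have h1 := rp_smul (ρ i) a x
        have h2 := rp_smul (ρ i) a (p i *ᵥ x)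
        refine Eq.trans (congrArg (fun z => p i *ᵥ z) h1) ?_
        exact (ev_comm (ρ i) (p i) (hc i) a x).trans h2.symm) }
  let β := φ.toLinearMap ∘ₗ pl
  have eq1 : ∀ (g : G) (x : M), α (M.ρ g x) = rp (ρ i) g (α x) := by
    intro g (x : Representation.asModule M.ρ)
    have h1 := map_smul α (MonoidAlgebra.single g (1 : k)) (x : Representation.asModule M.ρ)
    rw [Representation.single_smul, Representation.single_smul, one_smul, one_smul] at h1
    exact h1
  have eq2 : ∀ (g : G) (x : FM (ρ i)), β (rp (ρ i) g x) = M.ρ g (β x) := by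
    intro g (x : Representation.asModule (rp (ρ i)))
    have h1 := map_smul β (MonoidAlgebra.single g (1 : k)) (x : Representation.asModule (rp (ρ i)))
    rw [Representation.single_smul, Representation.single_smul, one_smul, one_smul] at h1
    exact h1
  refine ⟨mkHom M (FM (ρ i)) (α.restrictScalars k) ?_, mkHom (FM (ρ i)) M (β.restrictScalars k) ?_, ?_⟩
  · intro g; apply LinearMap.ext; intro x; exact eq1 g x
  · intro g; apply LinearMap.ext; intro x; exact eq2 g x
  · apply lin_ext
    apply LinearMap.ext
    intro x
    change φ (pl (φ.symm x).1) = x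
    have : pl (φ.symm x).1 = φ.symm x := by
      apply Subtype.ext
      exact (mem_piece (ρ i) (p i) (hc i) (φ.symm x).1).1 (φ.symm x).2
    exact (congrArg φ this).trans (φ.apply_symm_apply x)

end cls2
end A7

open CategoryTheory CategoryTheory.MonoidalCategory
open AlgebraicModule

namespace A7

section trace

lemma sum_symm_char2 {K ι : Type*} [CommRing K] [CharP K 2] [Fintype ι] [DecidableEq ι]
    (f : ι → ι → K) (h : ∀ i j, f i j = f j i) : ∑ i, ∑ j, f i j = ∑ i, f i i := by
  have h1 : ∑ i, ∑ j, f i j = ∑ x : ι × ι, f x.1 x.2 := by rw [Fintype.sum_prod_type]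
  have h2 : ∑ x : ι × ι, (if x.1 = x.2 then 0 else f x.1 x.2) = 0 := by
    apply Finset.sum_involution (fun x _ => (x.2, x.1))
    · rintro ⟨i, j⟩ _
      by_cases hij : i = j
      · simp [hij]
      · have hji : ¬ j = i := fun h => hij h.symm
        simp only [hij, hji, if_false]
        rw [h j i]
        exact CharTwo.add_self_eq_zero _
    · rintro ⟨i, j⟩ _ h3 h4
      apply h3
      have : j = i := congrArg Prod.fst h4
      simp [this]
    · intros; simp
    · intros; rfl
  have h3 : ∑ x : ι × ι, f x.1 x.2 = ∑ x : ι × ι, (if x.1 = x.2 then 0 else f x.1 x.2) +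
      ∑ x : ι × ι, (if x.1 = x.2 then f x.1 x.2 else 0) := by
    rw [← Finset.sum_add_distrib]
    apply Finset.sum_congr rfl
    intro x _
    split_ifs <;> simp
  rw [h1, h3, h2, zero_add, Fintype.sum_prod_type]
  apply Finset.sum_congr rfl
  intro i _
  simp

lemma trace_sq {K ι : Type*} [CommRing K] [CharP K 2] [Fintype ι] [DecidableEq ι]
    (A : Matrix ι ι K) : A.trace ^ 2 = (A * A).trace := by
  have h1 : A.trace ^ 2 = ∑ i, ∑ j, A i i * A j j := by
    rw [sq, Matrix.trace, Finset.sum_mul_sum]; rfl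
  have h2 : (A * A).trace = ∑ i, ∑ j, A i j * A j i := by
    simp [Matrix.trace, Matrix.mul_apply]
  rw [h1, h2, sum_symm_char2 _ (fun i j => mul_comm _ _), sum_symm_char2 _ (fun i j => mul_comm _ _)]

lemma trace_sq_lin {K V : Type*} [Field K] [CharP K 2] [AddCommGroup V] [Module K V]
    [FiniteDimensional K V] (f : Module.End K V) :
    LinearMap.trace K V f ^ 2 = LinearMap.trace K V (f * f) := by
  let b := Module.finBasis K V
  rw [LinearMap.trace_eq_matrix_trace K b, LinearMap.trace_eq_matrix_trace K b, trace_sq,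
    LinearMap.toMatrix_mul]

lemma pow420 (g : Equiv.Perm (Fin 7)) : g ^ 420 = 1 := by
  rw [← orderOf_dvd_iff_pow_eq_one, ← Equiv.Perm.lcm_cycleType, Multiset.lcm_dvd]
  intro n hn
  have h1 := Equiv.Perm.le_card_support_of_mem_cycleType hn
  have h2 := Finset.card_le_univ g.support
  have h3 := Equiv.Perm.two_le_of_mem_cycleType hn
  simp at h2
  have : n ≤ 7 := by omega
  interval_cases n <;> decide

lemma cyc_cases (h : Equiv.Perm (Fin 7)) (hh : h ^ 105 = 1) :
    h.cycleType = 0 ∨ h.cycleType = {3} ∨ h.cycleType = {3, 3} ∨ h.cycleType = {5} ∨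
      h.cycleType = {7} := by
  have hs : h.cycleType.sum ≤ 7 := by
    rw [Equiv.Perm.sum_cycleType]
    simpa using Finset.card_le_univ h.support
  have hm : ∀ n ∈ h.cycleType, n = 3 ∨ n = 5 ∨ n = 7 := by
    rw [← orderOf_dvd_iff_pow_eq_one, ← Equiv.Perm.lcm_cycleType, Multiset.lcm_dvd] at hh
    intro n hn
    have h1 := Equiv.Perm.le_card_support_of_mem_cycleType hn
    have h2 := Finset.card_le_univ h.support
    have h3 := Equiv.Perm.two_le_of_mem_cycleType hn
    have h4 := hh n hn
    simp at h2
    have : n ≤ 7 := by omega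
    interval_cases n <;> revert h4 <;> decide
  generalize h.cycleType = m at hs hm
  clear hh h
  induction m using Multiset.induction_on with
  | empty => left; rfl
  | cons a m _ =>
    right
    have ha := hm a (by simp)
    induction m using Multiset.induction_on with
    | empty =>
      rcases ha with rfl | rfl | rfl
      · left; rfl
      · right; right; left; rfl
      · right; right; right; rfl
    | cons b m _ =>
      have hb := hm b (by simp)
      simp only [Multiset.sum_cons] at hs
      have e1 : a = 3 := by omega
      have e2 : b = 3 := by omega
      induction m using Multiset.induction_on with
      | empty => right; left; rw [e1, e2]; rfl
      | cons c m _ =>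
        have hc := hm c (by simp)
        simp only [Multiset.sum_cons] at hs
        omega

/-- words of the class representatives -/
def repw (r : Fin 6) : List Tr :=
  match r with
  | 0 => []
  | 1 => [(0, 1, 2)]
  | 2 => [(0, 1, 2), (3, 4, 5)]
  | 3 => [(0, 1, 2), (2, 3, 4)]
  | 4 => [(0, 1, 2), (2, 3, 4), (4, 5, 6)]
  | 5 => [(4, 6, 5), (2, 4, 3), (0, 2, 1)]

lemma conj_cases (h r r' : G7) (t : Equiv.Perm (Fin 7)) (ht : Equiv.Perm.sign t = -1)
    (htr : t * r * t⁻¹ = r') (hc : (h : Equiv.Perm (Fin 7)).cycleType =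
      (r : Equiv.Perm (Fin 7)).cycleType) : (∃ s : G7, h = s * r * s⁻¹) ∨ ∃ s : G7, h = s * r' * s⁻¹ := by
  have h1 := Equiv.Perm.isConj_iff_cycleType_eq.2 hc.symm
  obtain ⟨s, hs⟩ := isConj_iff.1 h1
  rcases Int.units_eq_one_or (Equiv.Perm.sign s) with h2 | h2
  · left
    exact ⟨⟨s, Equiv.Perm.mem_alternatingGroup.2 h2⟩, Subtype.ext hs.symm⟩
  · right
    refine ⟨⟨s * t⁻¹, Equiv.Perm.mem_alternatingGroup.2 (by simp [h2, ht])⟩, Subtype.ext ?_⟩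
    simp only [Subgroup.coe_mul, Subgroup.coe_inv]
    rw [← htr, ← hs]
    group

theorem exists_rep (g : G7) : ∃ r : Fin 6, ∀ (K : Type) [Field K] [CharP K 2] (f : G7 → K),
    (∀ x, f x ^ 2 = f (x ^ 2)) → (∀ x y, f (y * x * y⁻¹) = f x) → f g = f (wd (repw r)) := by
  have hg : g ^ 420 = 1 := Subtype.ext (by simpa using pow420 g)
  have h1 : ∀ (K : Type) [Field K] [CharP K 2] (f : G7 → K),
    (∀ x, f x ^ 2 = f (x ^ 2)) → f g = f (g ^ 316) := by
    intro K _ _ f hf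
    have e1 : ∀ x, f x ^ 4 = f (x ^ 4) := by
      intro x
      rw [show 4 = 2 * 2 from rfl, pow_mul, hf, hf, ← pow_mul]
    have e2 : f g ^ 4 = f (g ^ 316) ^ 4 := by
      rw [e1, e1, ← pow_mul, show 316 * 4 = 420 * 3 + 4 from rfl, pow_add, pow_mul, hg, one_pow,
        one_mul]
    have e3 : ∀ x y : K, x ^ 2 = y ^ 2 → x = y := fun x y hxy => by
      have : (x + y) ^ 2 = 0 := by
        rw [CharTwo.add_sq, hxy]; exact CharTwo.add_self_eq_zero _
      have := pow_eq_zero_iff (two_ne_zero) |>.1 this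
      exact CharTwo.add_eq_zero.1 this
    apply e3
    apply e3
    rw [← pow_mul, ← pow_mul]
    exact e2
  have h2 : (g ^ 316) ^ 105 = 1 := by
    rw [← pow_mul, show 316 * 105 = 420 * 79 from rfl, pow_mul, hg, one_pow]
  have fin : ∀ (r : Fin 6), (∃ s, g ^ 316 = s * wd (repw r) * s⁻¹) → ∃ r : Fin 6,
      ∀ (K : Type) [Field K] [CharP K 2] (f : G7 → K),
    (∀ x, f x ^ 2 = f (x ^ 2)) → (∀ x y, f (y * x * y⁻¹) = f x) → f g = f (wd (repw r)) := by
    rintro r ⟨s, hs⟩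
    refine ⟨r, fun K _ _ f hf hc => ?_⟩
    rw [h1 K f hf, hs, hc]
  have h3 := cyc_cases (g ^ 316 : G7) (congrArg Subtype.val h2)
  rcases h3 with h3 | h3 | h3 | h3 | h3
  · rcases conj_cases (g ^ 316) (wd (repw 0)) (wd (repw 0)) (Equiv.swap 5 6) (by decide)
      (by decide +kernel) (h3.trans (by decide +kernel)) with h | h <;> exact fin _ h
  · rcases conj_cases (g ^ 316) (wd (repw 1)) (wd (repw 1)) (Equiv.swap 5 6) (by decide)
      (by decide +kernel) (h3.trans (by decide +kernel)) with h | h <;> exact fin _ h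
  · rcases conj_cases (g ^ 316) (wd (repw 2)) (wd (repw 2))
      (Equiv.swap 0 3 * Equiv.swap 1 4 * Equiv.swap 2 5) (by decide +kernel)
      (by decide +kernel) (h3.trans (by decide +kernel)) with h | h <;> exact fin _ h
  · rcases conj_cases (g ^ 316) (wd (repw 3)) (wd (repw 3)) (Equiv.swap 5 6) (by decide)
      (by decide +kernel) (h3.trans (by decide +kernel)) with h | h <;> exact fin _ h
  · rcases conj_cases (g ^ 316) (wd (repw 4)) (wd (repw 5))
      (Equiv.swap 1 6 * Equiv.swap 2 5 * Equiv.swap 3 4) (by decide +kernel)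
      (by decide +kernel) (h3.trans (by decide +kernel)) with h | h <;> exact fin _ h

/-- the trace hypothesis from an invertible character table -/
theorem traces_of {k : Type} [Field k] [CharP k 2] (n : Fin 6 → ℕ)
    (ρ : ∀ i, G7 →* Matrix (Fin (n i)) (Fin (n i)) k) (p : ∀ i, Matrix (Fin (n i)) (Fin (n i)) k)
    (hc : ∀ i g, p i * ρ i g = ρ i g * p i) (hp : ∀ i, p i * p i = p i)
    (N X : Matrix (Fin 6) (Fin 6) k) (hNX : N * X = 1)
    (hX : ∀ i r, Matrix.trace (ρ i (wd (repw r)) * p i) = X i r)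
    (V : Type) [AddCommGroup V] [Module (AlgebraicClosure k) V]
    [FiniteDimensional (AlgebraicClosure k) V] (T : G7 →* Module.End (AlgebraicClosure k) V) :
    ∃ a : Fin 6 → AlgebraicClosure k, ∀ g, LinearMap.trace _ V (T g) =
        ∑ i, a i * algebraMap k _ (Matrix.trace (ρ i g * p i)) := by
  have : CharP (AlgebraicClosure k) 2 := charP_of_injective_algebraMap
    (algebraMap k (AlgebraicClosure k)).injective 2
  refine ⟨fun i => ∑ s, algebraMap k _ (N s i) * LinearMap.trace _ V (T (wd (repw s))), fun g => ?_⟩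
  obtain ⟨r, hr⟩ := exists_rep g
  have e1 : LinearMap.trace _ V (T g) = LinearMap.trace _ V (T (wd (repw r))) :=
    hr _ (fun g => LinearMap.trace _ V (T g)) (fun x => by
      rw [trace_sq_lin, ← map_mul, sq x]) (fun x y => by
      rw [map_mul, LinearMap.trace_mul_comm, ← map_mul]
      simp)
  have e2 : ∀ i, Matrix.trace (ρ i g * p i) = X i r := fun i => by
    rw [← hX i r]
    refine hr k (fun g => Matrix.trace (ρ i g * p i)) (fun x => ?_) (fun x y => ?_)
    · rw [trace_sq]
      congr 1
      calc ρ i x * p i * (ρ i x * p i) = ρ i x * (p i * ρ i x) * p i := by simp only [Matrix.mul_assoc]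
        _ = ρ i (x ^ 2) * (p i * p i) := by rw [hc, sq, map_mul]; simp only [Matrix.mul_assoc]
        _ = _ := by rw [hp]
    · calc (ρ i (y * x * y⁻¹) * p i).trace = (ρ i y * (ρ i x * ρ i y⁻¹ * p i)).trace := by
            rw [map_mul, map_mul]; simp only [Matrix.mul_assoc]
        _ = (ρ i x * ρ i y⁻¹ * p i * ρ i y).trace := Matrix.trace_mul_comm _ _
        _ = (ρ i x * (ρ i y⁻¹ * ρ i y) * p i).trace := by
            congr 1
            simp only [Matrix.mul_assoc]
            rw [hc]
        _ = _ := by rw [← map_mul, inv_mul_cancel, map_one, Matrix.mul_one]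
  simp only [e1, e2, Finset.sum_mul]
  rw [Finset.sum_comm]
  have e3 : ∀ s, ∑ i, algebraMap k (AlgebraicClosure k) (N s i) *
      LinearMap.trace _ V (T (wd (repw s))) * algebraMap k _ (X i r) =
      (if s = r then LinearMap.trace _ V (T (wd (repw s))) else 0) := by
    intro s
    have h1 : (N * X) s r = if s = r then 1 else 0 := by rw [hNX, Matrix.one_apply]
    rw [Matrix.mul_apply] at h1
    have h2 := congrArg (algebraMap k (AlgebraicClosure k)) h1
    rw [map_sum] at h2
    have h3 : (if s = r then LinearMap.trace _ V (T (wd (repw s))) else 0) =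
       (algebraMap k (AlgebraicClosure k)) (if s = r then 1 else 0) *
        LinearMap.trace _ V (T (wd (repw s))) := by split_ifs <;> simp
    rw [h3, ← h2, Finset.sum_mul]
    apply Finset.sum_congr rfl
    intro i _
    rw [map_mul]; ring
  rw [Finset.sum_congr rfl (fun s _ => e3 s)]
  simp

end trace
end A7

open CategoryTheory CategoryTheory.MonoidalCategory
open AlgebraicModule

namespace A7
open scoped Matrix

lemma simple_cert {k G : Type} [Field k] [Group G] {n : ℕ} (ρ : G →* Matrix (Fin n) (Fin n) k)
    (p : Matrix (Fin n) (Fin n) k) (hc : ∀ g, p * ρ g = ρ g * p)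
    (E : List G) (v : Matrix (Fin n) (Fin 1) k) (φ : Matrix (Fin 1) (Fin n) k)
    (hE : (E.map fun g => ρ g * p).sum = v * φ)
    (xs : List (G × Matrix (Fin 1) (Fin n) k))
    (hx : p = (xs.map fun q => (ρ q.1 * v) * q.2).sum)
    (ys : List (Matrix (Fin n) (Fin 1) k × G))
    (hy : p = (ys.map fun q => q.1 * (φ * ρ q.2)).sum)
    (x y : Fin n → k) (hpx : p *ᵥ x = x) (hx0 : x ≠ 0) (hpy : p *ᵥ y = y) :
    y ∈ Submodule.span k (Set.range fun g => ρ g *ᵥ x) := by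
  set W := Submodule.span k (Set.range fun g => ρ g *ᵥ x) with hW
  have hsum : ∀ {α : Type} (l : List α) (f : α → Matrix (Fin n) (Fin n) k) (z : Fin n → k),
      (l.map f).sum *ᵥ z = (l.map fun a => f a *ᵥ z).sum := by
    intro α l f z
    induction l with
    | nil => simp
    | cons a l ih => simp [Matrix.add_mulVec, ih]
  have hcol : ∀ (u : Matrix (Fin n) (Fin 1) k) (s : Fin 1 → k), u *ᵥ s = s 0 • u.col 0 := by
    intro u s
    funext i
    simp [Matrix.mulVec, dotProduct, mul_comm]
  have hlist : ∀ l : List (Fin n → k), (∀ z ∈ l, z ∈ W) → l.sum ∈ W := fun l h =>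
    list_sum_mem h
  have hst : ∀ g, ∀ z ∈ W, ρ g *ᵥ z ∈ W := by
    intro g z hz
    have : W ≤ W.comap (Matrix.toLin' (ρ g)) := by
      rw [hW, Submodule.span_le]
      rintro _ ⟨h, rfl⟩
      rw [SetLike.mem_coe, Submodule.mem_comap, Matrix.toLin'_apply, Matrix.mulVec_mulVec, ← map_mul]
      exact Submodule.subset_span ⟨g * h, rfl⟩
    exact this hz
  have hxW : x ∈ W := Submodule.subset_span ⟨1, by simp⟩
  obtain ⟨q, hq, hq0⟩ : ∃ q ∈ ys, (φ * ρ q.2) *ᵥ x ≠ 0 := by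
    by_contra! h
    apply hx0
    rw [← hpx, hy, hsum]
    apply List.sum_eq_zero
    intro z hz
    rw [List.mem_map] at hz
    obtain ⟨q, hq, rfl⟩ := hz
    rw [← Matrix.mulVec_mulVec, h q hq, Matrix.mulVec_zero]
  have hvW : v.col 0 ∈ W := by
    have h1 : (E.map fun g => ρ g * p).sum *ᵥ (ρ q.2 *ᵥ x) ∈ W := by
      rw [hsum]
      apply hlist
      intro z hz
      rw [List.mem_map] at hz
      obtain ⟨g, _, rfl⟩ := hz
      have : (ρ g * p) *ᵥ ρ q.2 *ᵥ x = ρ g *ᵥ (ρ q.2 *ᵥ x) := by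
        rw [← Matrix.mulVec_mulVec, Matrix.mulVec_mulVec _ p, hc, ← Matrix.mulVec_mulVec, hpx]
      rw [this]
      exact hst _ _ (hst _ _ hxW)
    rw [hE, ← Matrix.mulVec_mulVec, Matrix.mulVec_mulVec _ φ, hcol] at h1
    have h2 : ((φ * ρ q.2) *ᵥ x) 0 ≠ 0 := by
      intro h; apply hq0; funext i; rw [Subsingleton.elim i 0, h]; rfl
    have h3 := W.smul_mem (((φ * ρ q.2) *ᵥ x) 0)⁻¹ h1
    rwa [smul_smul, inv_mul_cancel₀ h2, one_smul] at h3
  rw [← hpy, hx, hsum]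
  apply hlist
  intro z hz
  rw [List.mem_map] at hz
  obtain ⟨q, _, rfl⟩ := hz
  rw [← Matrix.mulVec_mulVec, ← Matrix.mulVec_mulVec, hcol, Matrix.mulVec_smul]
  exact W.smul_mem _ (hst _ _ hvW)

/-- action of a word on a coded matrix -/
def act (C : Tr → ℕ) (n m : ℕ) (w : List Tr) (v : ℕ) : ℕ :=
  w.foldr (fun t x => mulN n n m (C t) x) v

/-- right action of a word on a coded row -/
def ract (C : Tr → ℕ) (n : ℕ) (w : List Tr) (v : ℕ) : ℕ :=
  w.foldl (fun x t => mulN 1 n n x (C t)) v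

/-- certificate checker -/
def chk (C : Tr → ℕ) (n P : ℕ) (E : List (List Tr)) (v φ : ℕ) (xs : List (List Tr × ℕ))
    (ys : List (ℕ × List Tr)) : Prop :=
  (E.map fun w => act C n n w P).foldr Nat.xor 0 = mulN n 1 n v φ ∧
  P = (xs.map fun q => mulN n 1 n (act C n 1 q.1 v) q.2).foldr Nat.xor 0 ∧
  P = (ys.map fun q => mulN n 1 n q.1 (ract C n q.2 φ)).foldr Nat.xor 0 ∧
  mulN n n n P P = P

instance (C : Tr → ℕ) (n P : ℕ) (E : List (List Tr)) (v φ : ℕ) (xs : List (List Tr × ℕ))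
    (ys : List (ℕ × List Tr)) : Decidable (chk C n P E v φ xs ys) := by
  unfold chk; infer_instance

/-- writing a three-cycle with cycles through zero -/
def w0 (t : Tr) : List Tr := if dist3 t then
    (if t.1 = 0 then [(0, t.2.1, t.2.2)] else if t.2.1 = 0 then [(0, t.2.2, t.1)] else
      if t.2.2 = 0 then [(0, t.1, t.2.1)] else [(0, t.1, t.2.1), (0, t.2.1, t.2.2)]) else []

lemma w0_eq : ∀ t, ∀ i : Fin 7, (wd (w0 t)).1 i = (c3 t).1 i := by decide +kernel

lemma w0_zero : ∀ t, ∀ s ∈ w0 t, s.1 = 0 := by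
  intro t s hs
  unfold w0 at hs
  split_ifs at hs <;> simp at hs <;> aesop

lemma wd_w0 (w : List Tr) : wd (w.flatMap w0) = wd w := by
  induction w with
  | nil => rfl
  | cons t w ih =>
    rw [List.flatMap_cons, wd_append, ih, wd_cons]
    congr 1
    exact Subtype.ext (Equiv.ext (w0_eq t))

section
variable {k : Type} [Field k] [CharP k 2] {n : ℕ} (ρ : G7 →* Matrix (Fin n) (Fin n) k)
  (C : Tr → ℕ) (hC : ∀ t, ρ (c3 t) = mat k n n (C t))
include hC

lemma act_mat (m : ℕ) (w : List Tr) (v : ℕ) :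
    mat k n m (act C n m w v) = ρ (wd w) * mat k n m v := by
  induction w with
  | nil => simp [act, wd_nil]
  | cons t w ih =>
    rw [wd_cons, map_mul, hC, Matrix.mul_assoc, ← ih, mulN_mat]; rfl

lemma ract_mat (w : List Tr) (v : ℕ) :
    mat k 1 n (ract C n w v) = mat k 1 n v * ρ (wd w) := by
  induction w generalizing v with
  | nil => simp [ract, wd_nil]
  | cons t w ih =>
    rw [wd_cons, map_mul, hC, ← Matrix.mul_assoc, mulN_mat, ← ih]; rfl

lemma comm_of (P : ℕ) (h : ∀ b c, mulN n n n P (C (0, b, c)) = mulN n n n (C (0, b, c)) P) (g : G7) :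
    mat k n n P * ρ g = ρ g * mat k n n P := by
  obtain ⟨w, rfl⟩ := wd_surj g
  rw [← wd_w0]
  have hw : ∀ t ∈ w.flatMap w0, t.1 = 0 := by
    intro t ht
    obtain ⟨s, _, hs⟩ := List.mem_flatMap.1 ht
    exact w0_zero s t hs
  generalize w.flatMap w0 = w at hw
  induction w with
  | nil => simp [wd_nil]
  | cons t w ih =>
    obtain ⟨a, b, c⟩ := t
    obtain rfl : a = 0 := hw (a, b, c) (by simp)
    rw [wd_cons, map_mul, Matrix.mul_assoc, ← ih (fun t ht => hw t (by simp [ht])), ← Matrix.mul_assoc,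
      ← Matrix.mul_assoc, hC, mulN_mat, mulN_mat, h]

lemma simple_of_chk (P : ℕ) (h : ∀ b c, mulN n n n P (C (0, b, c)) = mulN n n n (C (0, b, c)) P)
    (E : List (List Tr)) (v φ : ℕ) (xs : List (List Tr × ℕ))
    (ys : List (ℕ × List Tr)) (hk : chk C n P E v φ xs ys)
    (x y : Fin n → k) (hpx : mat k n n P *ᵥ x = x) (hx0 : x ≠ 0) (hpy : mat k n n P *ᵥ y = y) :
    y ∈ Submodule.span k (Set.range fun g => ρ g *ᵥ x) := by
  obtain ⟨h1, h2, h3, _⟩ := hk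
  refine simple_cert ρ (mat k n n P) (comm_of ρ C hC P h) (E.map wd) (mat k n 1 v) (mat k 1 n φ)
    ?_ (xs.map fun q => (wd q.1, mat k 1 n q.2)) ?_ (ys.map fun q => (mat k n 1 q.1, wd q.2)) ?_
    x y hpx hx0 hpy
  · rw [mulN_mat, ← h1, mat_foldr, List.map_map, List.map_map]
    congr 1
    apply List.map_congr_left
    intro w _
    exact (act_mat ρ C hC n w P).symm
  · conv_lhs => rw [h2]
    rw [mat_foldr, List.map_map, List.map_map]
    congr 1
    apply List.map_congr_left
    intro q _
    change mat k n n (mulN n 1 n (act C n 1 q.1 v) q.2) = ρ (wd q.1) * mat k n 1 v * mat k 1 n q.2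
    rw [← mulN_mat, act_mat ρ C hC]
  · conv_lhs => rw [h3]
    rw [mat_foldr, List.map_map, List.map_map]
    congr 1
    apply List.map_congr_left
    intro q _
    change mat k n n (mulN n 1 n q.1 (ract C n q.2 φ)) = mat k n 1 q.1 * (mat k 1 n φ * ρ (wd q.2))
    rw [← mulN_mat, ract_mat ρ C hC]

end

end A7

open CategoryTheory CategoryTheory.MonoidalCategory
open AlgebraicModule

namespace A7
open scoped Matrix

/-- the three-cycle as a function on numbers -/
def pf (t : Tr) (j : ℕ) : ℕ := cond (decide (dist3 t))
  (cond (Nat.beq j t.1) t.2.1 (cond (Nat.beq j t.2.1) t.2.2 (cond (Nat.beq j t.2.2) t.1 j))) j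

lemma pf_eq : ∀ (t : Tr) (j : Fin 7), ((c3 t).1 j : ℕ) = pf t j := by decide +kernel

lemma beq_of {a b : ℕ} (h : a = b) : Nat.beq a b = true := by rw [Nat.beq_eq]; exact h

/-- index of a pair -/
def ixN (a b : ℕ) : ℕ := cond (Nat.ble a b) (Nat.add (Nat.div (Nat.mul b (Nat.sub b 1)) 2) a)
  (Nat.add (Nat.div (Nat.mul a (Nat.sub a 1)) 2) b)

/-- larger element of a pair -/
def hiN (i : ℕ) : ℕ := [1, 2, 2, 3, 3, 3, 4, 4, 4, 4, 5, 5, 5, 5, 5, 6, 6, 6, 6, 6, 6].getD i 0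
/-- smaller element of a pair -/
def loN (i : ℕ) : ℕ := [0, 0, 1, 0, 1, 2, 0, 1, 2, 3, 0, 1, 2, 3, 4, 0, 1, 2, 3, 4, 5].getD i 0

/-- index of a pair -/
def ix (a b : Fin 7) : Fin 21 := Fin.ofNat 21 (ixN a b)
/-- larger element -/
def hi (i : Fin 21) : Fin 7 := Fin.ofNat 7 (hiN i)
/-- smaller element -/
def lo (i : Fin 21) : Fin 7 := Fin.ofNat 7 (loN i)

lemma ix_symm : ∀ a b, ix a b = ix b a := by decide +kernel
lemma lo_ix : ∀ a b, a ≠ b → (lo (ix a b) = a ∧ hi (ix a b) = b) ∨ (lo (ix a b) = b ∧ hi (ix a b) = a) := by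
  decide +kernel
lemma ix_lo : ∀ i, ix (lo i) (hi i) = i := by decide +kernel
lemma lo_ne : ∀ i, lo i ≠ hi i := by decide +kernel
lemma ixN_lt : ∀ a b : Fin 7, a ≠ b → ixN a b < 21 := by decide +kernel
lemma lo_val : ∀ i : Fin 21, (lo i : ℕ) = loN i := by decide +kernel
lemma hi_val : ∀ i : Fin 21, (hi i : ℕ) = hiN i := by decide +kernel

/-- action on pairs -/
instance act21 : MulAction G7 (Fin 21) where
  smul g i := ix (g.1 (lo i)) (g.1 (hi i))
  one_smul i := ix_lo i
  mul_smul g h i := by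
    change ix (g.1 (h.1 (lo i))) (g.1 (h.1 (hi i))) =
      ix (g.1 (lo (ix (h.1 (lo i)) (h.1 (hi i))))) (g.1 (hi (ix (h.1 (lo i)) (h.1 (hi i)))))
    rcases lo_ix (h.1 (lo i)) (h.1 (hi i)) (fun e => lo_ne i (h.1.injective e)) with ⟨h1, h2⟩ | ⟨h1, h2⟩
    · rw [h1, h2]
    · rw [h1, h2, ix_symm]

lemma smul21 (g : G7) (i : Fin 21) : g • i = ix (g.1 (lo i)) (g.1 (hi i)) := rfl

/-- generator codes -/
def C7 (t : Tr) : ℕ := ofFnN 7 7 fun i j => cond (Nat.beq i (pf t j)) 1 0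
/-- generator codes -/
def C21 (t : Tr) : ℕ := ofFnN 21 21 fun i j => cond (Nat.beq i (ixN (pf t (loN j)) (pf t (hiN j)))) 1 0
/-- generator codes -/
def C28 (t : Tr) : ℕ := ofFnN 28 28 fun i j =>
  cond (Nat.beq (Nat.mod i 7) (pf t (Nat.mod j 7)))
    (bn (m3N t) (Nat.add (Nat.mul (Nat.div i 7) 4) (Nat.div j 7))) 0

section
variable (k : Type) [Field k] [CharP k 2]

/-- representation on points -/
noncomputable def r7 : G7 →* Matrix (Fin 7) (Fin 7) k := permM k G7 (Fin 7)
/-- representation on pairs -/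
noncomputable def r21 : G7 →* Matrix (Fin 21) (Fin 21) k := permM k G7 (Fin 21)
/-- the tensor representation -/
noncomputable def r28 : G7 →* Matrix (Fin 28) (Fin 28) k where
  toFun g := (kr (phi k) (permM k G7 (Fin 7)) g).submatrix (finProdFinEquiv (m := 4) (n := 7)).symm
    (finProdFinEquiv (m := 4) (n := 7)).symm
  map_one' := by rw [map_one]; exact Matrix.submatrix_one_equiv _
  map_mul' g h := by rw [map_mul]; exact (Matrix.submatrix_mul_equiv _ _ _ _ _).symm

lemma smul7 (g : G7) (i : Fin 7) : g • i = g.1 i := rfl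

lemma r7_C (t : Tr) : r7 k (c3 t) = mat k 7 7 (C7 t) := by
  ext i j
  rw [C7, ofFnN_mat, r7, permM_apply, smul7, ← pf_eq]
  simp only [Fin.ext_iff]
  by_cases h : (i : ℕ) = ((c3 t).1 j : ℕ)
  · rw [if_pos h, beq_of h]; simp
  · rw [if_neg h, show Nat.beq i ((c3 t).1 j : ℕ) = false by rwa [← Bool.not_eq_true, Nat.beq_eq]]; simp

lemma r21_C (t : Tr) : r21 k (c3 t) = mat k 21 21 (C21 t) := by
  ext i j
  rw [C21, ofFnN_mat, r21, permM_apply, smul21, ← lo_val, ← hi_val, ← pf_eq, ← pf_eq]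
  simp only [Fin.ext_iff]
  have e : (ix ((c3 t).1 (lo j)) ((c3 t).1 (hi j)) : ℕ) = ixN ((c3 t).1 (lo j)) ((c3 t).1 (hi j)) :=
    Nat.mod_eq_of_lt (ixN_lt _ _ fun e => lo_ne j ((c3 t).1.injective e))
  rw [e]
  by_cases h : (i : ℕ) = ixN ((c3 t).1 (lo j)) ((c3 t).1 (hi j))
  · rw [if_pos h, beq_of h]; simp
  · rw [if_neg h, show Nat.beq i (ixN ((c3 t).1 (lo j)) ((c3 t).1 (hi j))) = false by rwa [← Bool.not_eq_true, Nat.beq_eq]]; simp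

lemma r28_C (t : Tr) : r28 k (c3 t) = mat k 28 28 (C28 t) := by
  ext i j
  rw [C28, ofFnN_mat]
  have e0 : r28 k (c3 t) i j = phi k (c3 t) (Fin.divNat (m := 4) (n := 7) i) (Fin.divNat (m := 4) (n := 7) j) *
    permM k G7 (Fin 7) (c3 t) (Fin.modNat (m := 4) (n := 7) i) (Fin.modNat (m := 4) (n := 7) j) := rfl
  rw [e0]
  have e1 : Nat.mod (i : ℕ) 7 = (Fin.modNat (m := 4) (n := 7) i : ℕ) := rfl
  have e2 : Nat.mod (j : ℕ) 7 = (Fin.modNat (m := 4) (n := 7) j : ℕ) := rfl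
  have e3 : Nat.div (i : ℕ) 7 = (Fin.divNat (m := 4) (n := 7) i : ℕ) := rfl
  have e4 : Nat.div (j : ℕ) 7 = (Fin.divNat (m := 4) (n := 7) j : ℕ) := rfl
  rw [phi_c3, permM_apply, smul7, e1, e2, e3, e4, ← pf_eq, mat_apply, ← bn_cast]
  simp only [Fin.ext_iff]
  by_cases h : (Fin.modNat (m := 4) (n := 7) i : ℕ) = ((c3 t).1 (Fin.modNat (m := 4) (n := 7) j) : ℕ)
  · rw [if_pos h, beq_of h, mul_one]; rfl
  · rw [if_neg h, show Nat.beq (Fin.modNat (m := 4) (n := 7) i : ℕ)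
      ((c3 t).1 (Fin.modNat (m := 4) (n := 7) j) : ℕ) = false by rwa [← Bool.not_eq_true, Nat.beq_eq]]; simp
end

/-- certificates -/
structure Cert where
  /-- projection -/
  P : ℕ
  /-- words -/
  E : List (List Tr)
  /-- column -/
  v : ℕ
  /-- row -/
  f : ℕ
  /-- column span -/
  xs : List (List Tr × ℕ)
  /-- row span -/
  ys : List (ℕ × List Tr)

/-- certificate data for piece 0 -/
def cert0 : Cert := ⟨562949953421311, [[]],
  127, 127,
  [([], 127)],
  [(127, [])]⟩

/-- certificate data for piece 1 -/
def cert1 : Cert := ⟨280371153272574, [[], [(0, 5, 4), (0, 3, 4), (0, 1, 2)], [(1, 2, 3), (0, 1, 2)], [(1, 3, 2), (0, 5, 4), (0, 1, 4)], [(4, 5, 6)], [(0, 6, 4), (0, 3, 4), (0, 1, 2)], [(4, 5, 6), (1, 2, 3), (0, 1, 2)], [(1, 3, 2), (0, 6, 4), (0, 1, 4)], [(4, 6, 5)], [(0, 6, 5), (0, 3, 5), (0, 1, 2)], [(4, 6, 5), (1, 2, 3), (0, 1, 2)], [(1, 3, 2), (0, 6, 5), (0, 1, 5)]],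
  15, 15,
  [([], 120), ([(0, 1, 4)], 105), ([(0, 1, 5)], 95), ([(0, 1, 6)], 63), ([(0, 4, 1)], 10), ([(0, 4, 2)], 12)],
  [(113, []), (99, [(0, 1, 4)]), (95, [(0, 1, 5)]), (63, [(0, 1, 6)]), (5, [(0, 2, 4)]), (9, [(0, 3, 4)])]⟩

/-- certificate data for piece 2 -/
def cert2 : Cert := ⟨2769981921907364938761350319248889911302453471429589475981168607799836849598742399654878374244866233974353704382547173917415338784, [[], [(0, 5, 4), (0, 3, 4), (0, 1, 2)], [(1, 2, 3), (0, 1, 2)], [(1, 3, 2), (0, 5, 4), (0, 1, 4)], [(4, 5, 6)], [(0, 6, 4), (0, 3, 4), (0, 1, 2)], [(4, 5, 6), (1, 2, 3), (0, 1, 2)], [(1, 3, 2), (0, 6, 4), (0, 1, 4)], [(4, 6, 5)], [(0, 6, 5), (0, 3, 5), (0, 1, 2)], [(4, 6, 5), (1, 2, 3), (0, 1, 2)], [(1, 3, 2), (0, 6, 5), (0, 1, 5)]],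
  45, 45,
  [([], 1995552), ([(0, 1, 2)], 338596), ([(0, 1, 4)], 1183769), ([(0, 1, 5)], 885030), ([(0, 1, 6)], 28377), ([(0, 2, 4)], 304179), ([(0, 2, 5)], 197196), ([(0, 2, 6)], 6579), ([(0, 4, 1)], 1521716), ([(0, 5, 1)], 983988), ([(0, 6, 1)], 31668), ([(0, 1, 5), (0, 1, 4)], 491583), ([(0, 1, 6), (0, 1, 4)], 15423), ([(0, 1, 6), (0, 1, 5)], 1023)],
  [(1893960, []), (338596, [(0, 1, 2)]), (1521716, [(0, 1, 4)]), (983988, [(0, 1, 5)]), (31668, [(0, 1, 6)]), (304179, [(0, 2, 4)]), (197196, [(0, 2, 5)]), (6579, [(0, 2, 6)]), (1183769, [(0, 4, 1)]), (885030, [(0, 5, 1)]), (28377, [(0, 6, 1)]), (491583, [(0, 1, 5), (0, 1, 4)]), (15423, [(0, 1, 6), (0, 1, 4)]), (1023, [(0, 1, 6), (0, 1, 5)])]⟩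

/-- certificate data for piece 3 -/
def cert3 : Cert := ⟨100950936809832843317439261805007060962182874918262383647682173865082782780497998493371028672010476107182442809548658798901900695732343218906546437146629280764742908726498395916650446743939975968597552597325523902129318998363981152780415, [[], [(0, 5, 6), (0, 3, 4), (0, 1, 2)], [(1, 4, 6), (0, 3, 5), (0, 2, 1)], [(2, 3, 6), (1, 2, 5), (0, 1, 4)], [(0, 6, 3), (0, 5, 2), (0, 4, 1)], [(2, 6, 4), (1, 5, 3), (0, 1, 2)], [(4, 6, 5), (2, 4, 3), (0, 2, 1)]],
  268435328, 2080895,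
  [([], 268435328), ([(0, 1, 2)], 2097024), ([(0, 1, 3)], 127), ([(0, 2, 3)], 266354560)],
  [(2097024, []), (268419199, [(0, 1, 2)]), (268435455, [(0, 1, 3)]), (2097151, [(0, 2, 3)])]⟩

/-- certificate data for piece 4 -/
def cert4 : Cert := ⟨90886506807735075659422180921844779337632637575420254404556625369490709156433398503075570492738713464620118679989348135869531599100960398165582122733903277235646703848536594035441137434950836785714395325375823703457947931529872675907413, [[], [(0, 5, 6), (0, 3, 4), (0, 1, 2)], [(1, 4, 6), (0, 3, 5), (0, 2, 1)], [(2, 3, 6), (1, 2, 5), (0, 1, 4)], [(0, 6, 3), (0, 5, 2), (0, 4, 1)], [(2, 6, 4), (1, 5, 3), (0, 1, 2)], [(4, 6, 5), (2, 4, 3), (0, 2, 1)]],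
  175355086, 239465163,
  [([], 57900152), ([(0, 1, 2)], 221679283), ([(0, 1, 3)], 83644107), ([(0, 2, 3)], 83061150)],
  [(161930812, []), (64318194, [(0, 1, 2)]), (91463168, [(0, 1, 3)]), (214659863, [(0, 2, 3)])]⟩

/-- certificate data for piece 5 -/
def cert5 : Cert := ⟨61475604307047099967760571989545272050823390013560252649793550009393670483057682445729387810428322670967111027278687496847289284471673369256502609131902977949918673065994278111754172198110305200867970277078231335448273051435245205661483, [[], [(0, 5, 4), (0, 3, 4), (0, 1, 2)], [(1, 2, 3), (0, 1, 2)], [(1, 3, 2), (0, 5, 4), (0, 1, 4)], [(4, 5, 6)], [(0, 6, 4), (0, 3, 4), (0, 1, 2)], [(4, 5, 6), (1, 2, 3), (0, 1, 2)], [(1, 3, 2), (0, 6, 4), (0, 1, 4)], [(4, 6, 5)], [(0, 6, 5), (0, 3, 5), (0, 1, 2)], [(4, 6, 5), (1, 2, 3), (0, 1, 2)], [(1, 3, 2), (0, 6, 5), (0, 1, 5)]],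
  101974112, 169095248,
  [([], 126039379), ([(0, 1, 2)], 114712169), ([(0, 1, 4)], 83532285), ([(0, 1, 5)], 120901374), ([(0, 2, 4)], 11854872), ([(0, 2, 5)], 91864064), ([(0, 4, 1)], 113792509), ([(0, 4, 2)], 10938440), ([(0, 4, 3)], 1236181), ([(0, 5, 1)], 21528294), ([(0, 5, 2)], 57523320), ([(0, 5, 3)], 239465148), ([(1, 2, 4)], 108698029), ([(1, 2, 5)], 121503390), ([(1, 4, 2)], 250363309), ([(1, 4, 3)], 82749929), ([(1, 5, 2)], 91246310), ([(1, 5, 3)], 119921882), ([(0, 1, 5), (0, 1, 4)], 169095248), ([(0, 2, 5), (0, 1, 4)], 101460016)],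
  [(227391466, []), (10694630, [(0, 1, 2)]), (258428346, [(0, 1, 4)]), (84289365, [(0, 1, 5)]), (1969835, [(0, 2, 4)]), (251664181, [(0, 2, 5)]), (120416962, [(0, 3, 4)]), (26633648, [(0, 3, 5)]), (107441513, [(0, 4, 1)]), (151660283, [(0, 4, 2)]), (1979221, [(0, 4, 5)]), (96528071, [(0, 5, 1)]), (91450667, [(1, 2, 4)]), (113697735, [(1, 2, 5)]), (175001401, [(1, 3, 4)]), (222353063, [(1, 3, 5)]), (208365401, [(1, 4, 2)]), (163640547, [(1, 4, 5)]), (101974112, [(0, 1, 5), (0, 1, 4)]), (169345072, [(0, 3, 5), (0, 1, 4)])]⟩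

/-- sizes -/
def nn : Fin 6 → ℕ
  | 0 => 7 | 1 => 7 | 2 => 21 | 3 => 28 | 4 => 28 | 5 => 28
/-- all generator codes -/
def CC : Fin 6 → Tr → ℕ
  | 0 => C7 | 1 => C7 | 2 => C21 | 3 => C28 | 4 => C28 | 5 => C28
/-- all certificates -/
def cert : Fin 6 → Cert
  | 0 => cert0 | 1 => cert1 | 2 => cert2 | 3 => cert3 | 4 => cert4 | 5 => cert5

/-- diagonal sum -/
def trc (n M : ℕ) : ℕ := xsum n fun i => bn M (Nat.add (Nat.mul i n) i)

set_option maxRecDepth 100000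
lemma comm7 : ∀ b c, mulN 7 7 7 cert0.P (C7 (0, b, c)) = mulN 7 7 7 (C7 (0, b, c)) cert0.P ∧
   mulN 7 7 7 cert1.P (C7 (0, b, c)) = mulN 7 7 7 (C7 (0, b, c)) cert1.P := by decide +kernel
lemma comm21 : ∀ b c, mulN 21 21 21 cert2.P (C21 (0, b, c)) = mulN 21 21 21 (C21 (0, b, c)) cert2.P := by
  decide +kernel
lemma comm28 : ∀ b c, mulN 28 28 28 cert3.P (C28 (0, b, c)) = mulN 28 28 28 (C28 (0, b, c)) cert3.P ∧
  mulN 28 28 28 cert4.P (C28 (0, b, c)) = mulN 28 28 28 (C28 (0, b, c)) cert4.P ∧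
  mulN 28 28 28 cert5.P (C28 (0, b, c)) = mulN 28 28 28 (C28 (0, b, c)) cert5.P := by
  decide +kernel
lemma chk0 : chk C7 7 cert0.P cert0.E cert0.v cert0.f cert0.xs cert0.ys := by decide +kernel
lemma chk1 : chk C7 7 cert1.P cert1.E cert1.v cert1.f cert1.xs cert1.ys := by decide +kernel
lemma chk2 : chk C21 21 cert2.P cert2.E cert2.v cert2.f cert2.xs cert2.ys := by decide +kernel
lemma chk3 : chk C28 28 cert3.P cert3.E cert3.v cert3.f cert3.xs cert3.ys := by decide +kernel
lemma chk4 : chk C28 28 cert4.P cert4.E cert4.v cert4.f cert4.xs cert4.ys := by decide +kernel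
lemma chk5 : chk C28 28 cert5.P cert5.E cert5.v cert5.f cert5.xs cert5.ys := by decide +kernel
lemma trc_check : ∀ i r, trc (nn i) (act (CC i) (nn i) (nn i) (repw r) (cert i).P) % 2 = bn 56580165311 ((i : ℕ) * 6 + r) := by
  decide +kernel
lemma table_inv : mulN 6 6 6 21692123579 56580165311 = oneN 6 := by decide +kernel
end A7

open CategoryTheory CategoryTheory.MonoidalCategory
open AlgebraicModule

namespace A7
open scoped Matrix

section
variable (k : Type) [Field k] [CharP k 2]

/-- the six representations -/
noncomputable def rr : ∀ i : Fin 6, G7 →* Matrix (Fin (nn i)) (Fin (nn i)) k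
  | 0 => r7 k | 1 => r7 k | 2 => r21 k | 3 => r28 k | 4 => r28 k | 5 => r28 k

lemma rr_C : ∀ (i : Fin 6) (t : Tr), rr k i (c3 t) = mat k (nn i) (nn i) (CC i t)
  | 0 => r7_C k | 1 => r7_C k | 2 => r21_C k | 3 => r28_C k | 4 => r28_C k | 5 => r28_C k

lemma comm_all : ∀ (i : Fin 6) (b c : Fin 7), mulN (nn i) (nn i) (nn i) (cert i).P (CC i (0, b, c)) =
    mulN (nn i) (nn i) (nn i) (CC i (0, b, c)) (cert i).P
  | 0 => fun b c => (comm7 b c).1 | 1 => fun b c => (comm7 b c).2 | 2 => comm21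
  | 3 => fun b c => (comm28 b c).1 | 4 => fun b c => (comm28 b c).2.1 | 5 => fun b c => (comm28 b c).2.2

lemma chk_all : ∀ i : Fin 6, chk (CC i) (nn i) (cert i).P (cert i).E (cert i).v (cert i).f (cert i).xs (cert i).ys
  | 0 => chk0 | 1 => chk1 | 2 => chk2 | 3 => chk3 | 4 => chk4 | 5 => chk5

lemma nz_all : ∀ i : Fin 6, ∃ a b : Fin (nn i), (cert i).P.testBit (a * nn i + b) = true := by
  decide +kernel

lemma trace_trc (n M : ℕ) : Matrix.trace (mat k n n M) = bk k (trc n M) 0 := by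
  rw [trc, bk_xsum, Finset.sum_range, Matrix.trace]
  apply Finset.sum_congr rfl
  intro i _
  rw [Matrix.diag_apply, mat_apply, bn_eq]
  unfold bk
  change _ = if (if M.testBit ((i : ℕ) * n + i) = true then 1 else 0).testBit 0 = true then (1 : k) else 0
  by_cases h : M.testBit ((i : ℕ) * n + i) = true <;> simp [h]

lemma bk_mod (M N s : ℕ) (h : M % 2 = bn N s) : bk k M 0 = bk k N s := by
  rw [← bn_cast, ← bn_cast, ← h]
  rfl

theorem six (M : FDRep k G7) (hM : Simple M) : ∃ i, IsSummand M (FM (rr k i)) := by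
  have hc := fun i => comm_of (rr k i) (CC i) (rr_C k i) (cert i).P (comm_all i)
  have hp : ∀ i, mat k (nn i) (nn i) (cert i).P * mat k (nn i) (nn i) (cert i).P =
      mat k (nn i) (nn i) (cert i).P := fun i => by rw [mulN_mat, (chk_all i).2.2.2]
  refine classify nn (rr k) (fun i => mat k (nn i) (nn i) (cert i).P) hc hp ?_ ?_ ?_ M hM
  · intro i h
    obtain ⟨a, b, hab⟩ := nz_all i
    have := congrFun (congrFun h a) b
    rw [mat_apply, bk, if_pos hab] at this
    exact one_ne_zero this
  · intro i x y h1 h2 h3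
    exact simple_of_chk (rr k i) (CC i) (rr_C k i) (cert i).P (comm_all i) _ _ _ _ _ (chk_all i) x y h1 h2 h3
  · refine traces_of nn (rr k) _ hc hp (mat k 6 6 21692123579) (mat k 6 6 56580165311) ?_ ?_
    · rw [mulN_mat, table_inv, mat_oneN]
    · intro i r
      rw [← act_mat (rr k i) (CC i) (rr_C k i), trace_trc, mat_apply]
      exact bk_mod k _ _ _ (trc_check i r)

/-- reindexing -/
noncomputable def iso28 : FM (kr (phi k) (permM k G7 (Fin 7))) ≅ FM (r28 k) :=
  mkIso' _ _ (LinearEquiv.funCongrLeft k k (finProdFinEquiv (m := 4) (n := 7)).symm) (fun g => by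
    apply LinearMap.ext
    intro x
    exact (Matrix.submatrix_mulVec_equiv (kr (phi k) (permM k G7 (Fin 7)) g)
      (x ∘ (finProdFinEquiv (m := 4) (n := 7)).symm) _ (finProdFinEquiv (m := 4) (n := 7)).symm).symm.trans (by rfl))

lemma summand_iso {M A B : FDRep k G7} (h : IsSummand M A) (e : A ≅ B) : IsSummand M B := by
  obtain ⟨i, r, h⟩ := h
  exact ⟨i ≫ e.hom, e.inv ≫ r, by simp [h]⟩

theorem main (M : FDRep k G7) (hM : Simple M) : IsAlgebraic M := by
  obtain ⟨i, hi⟩ := six k M hM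
  have h7 : IsSummand M (FM (r7 k)) → IsAlgebraic M := fun h =>
    algebraic_of fac3 M ⟨Fin 7, inferInstance, inferInstance, inferInstance, Or.inl h⟩
  have h21 : IsSummand M (FM (r21 k)) → IsAlgebraic M := fun h =>
    algebraic_of fac3 M ⟨Fin 21, inferInstance, inferInstance, inferInstance, Or.inl h⟩
  have h28 : IsSummand M (FM (r28 k)) → IsAlgebraic M := fun h =>
    algebraic_of fac3 M ⟨Fin 7, inferInstance, inferInstance, inferInstance,
      Or.inr (summand_iso k h ((iso28 k).symm ≪≫ (tensorFM _ _).symm))⟩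
  match i, hi with
  | 0, h => exact h7 h
  | 1, h => exact h7 h
  | 2, h => exact h21 h
  | 3, h => exact h28 h
  | 4, h => exact h28 h
  | 5, h => exact h28 h
end
end A7

/-- Every simple module in characteristic `2` for `alternatingGroup (Fin 7)` is algebraic. -/
theorem alt7_char2_simple_algebraic (k : Type) [Field k] (hk : CharP k 2)
    (M : FDRep k (alternatingGroup (Fin 7))) (hM : Simple M) : IsAlgebraic M := by
  haveI := hk
  exact A7.main k M hM
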